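/- arXiv:1910.02193 — 2 statements merged into one kernel-verified Lean document; each statement's English description precedes it below -/
import Mathlib

section
/- Let P ∈ ℝ^{n×n} be an ergodic row-stochastic Markov matrix with stationary distribution π, π_max = max_i π_i, π_min = min_i π_i, and τ_* = τ(1/4). Let X_0, ..., X_N be a trajectory of the chain and let X̂_0, ..., X̂_N be any sequence in [n] with Σ_{t=0}^N 1{X̂_t ≠ X_t} = N' perturbed positions. Define P̂ by P̂(i,j) = (Σ_{t=1}^N 1{X̂_{t−1}=i, X̂_t=j}) / (Σ_{t=1}^N 1{X̂_{t−1}=i}) when the denominator is nonzero and P̂(i,j) = 1/n otherwise. If N' < N π_min / 2, then for every ε > 0, setting ε̃ = min{π_min/2 − N'/N, ε}, one has Prob(‖P̂ − P‖ ≤ 4 π_min^{-1} ‖P‖ (ε + 1.5 N'/N)) ≥ 1 − 24 n τ_* log(ε̃^{-1}) exp(−N / (100 τ_* π_max log(ε̃^{-1}) ε̃^{-2})), where ‖·‖ is the spectral norm. -/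
open scoped BigOperators
open Matrix

noncomputable section

namespace MJ

/-- Euclidean (ℓ2) norm of a finite vector. -/
def l2 {k : ℕ} (v : Fin k → ℝ) : ℝ := Real.sqrt (∑ j, v j ^ 2)

/-- ℓ1 norm of a finite vector. -/
def l1 {k : ℕ} (v : Fin k → ℝ) : ℝ := ∑ i, |v i|

/-- Maximum absolute row sum (matrix ∞-norm). -/
def rowSumNorm {m k : ℕ} (A : Matrix (Fin m) (Fin k) ℝ) : ℝ := ⨆ i, ∑ j, |A i j|

/-- Frobenius norm. -/
def frob {m k : ℕ} (A : Matrix (Fin m) (Fin k) ℝ) : ℝ := Real.sqrt (∑ i, ∑ j, A i j ^ 2)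

/-- Spectral norm (ℓ2 operator norm). -/
def spec {m k : ℕ} (A : Matrix (Fin m) (Fin k) ℝ) : ℝ :=
  sSup {c : ℝ | ∃ x : Fin k → ℝ, l2 x ≤ 1 ∧ c = l2 (A.mulVec x)}

/-- `i`-th largest singular value (1-indexed), via Courant–Fischer max-min. -/
def singVal {m k : ℕ} (A : Matrix (Fin m) (Fin k) ℝ) (i : ℕ) : ℝ :=
  sSup {c : ℝ | ∃ V : Submodule ℝ (Fin k → ℝ), Module.finrank ℝ V = i ∧
    ∀ x ∈ V, c * l2 x ≤ l2 (A.mulVec x)}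

/-- Row-stochastic matrix. -/
def RowStochastic {k : ℕ} (P : Matrix (Fin k) (Fin k) ℝ) : Prop :=
  (∀ i j, 0 ≤ P i j) ∧ ∀ i, ∑ j, P i j = 1

/-- Probability vector. -/
def IsProbVec {k : ℕ} (v : Fin k → ℝ) : Prop := (∀ i, 0 ≤ v i) ∧ ∑ i, v i = 1

/-- Stationary distribution: a probability vector with πᵀ P = πᵀ. -/
def IsStationary {k : ℕ} (P : Matrix (Fin k) (Fin k) ℝ) (piv : Fin k → ℝ) : Prop :=
  IsProbVec piv ∧ ∀ j, ∑ i, piv i * P i j = piv j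

/-- Ergodicity (irreducible + aperiodic ⟺ primitive for finite chains). -/
def Ergodic' {k : ℕ} (P : Matrix (Fin k) (Fin k) ℝ) : Prop :=
  ∃ t : ℕ, ∀ i j, 0 < (P ^ t) i j

/-- ε-mixing time: τ(ε) = min{t : max_i (1/2)‖(P^t)(i,:) − π‖₁ ≤ ε}. -/
def mixingTime {k : ℕ} (P : Matrix (Fin k) (Fin k) ℝ) (piv : Fin k → ℝ) (ε : ℝ) : ℕ :=
  sInf {t : ℕ | ∀ i, (1/2) * ∑ j, |(P ^ t) i j - piv j| ≤ ε}

/-- Full SVD decomposition predicate: A = U S Vᵀ with U, V orthogonal and S diagonal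
with nonnegative entries arranged in descending order. -/
def IsSVD {m k : ℕ} (A : Matrix (Fin m) (Fin k) ℝ) (U : Matrix (Fin m) (Fin m) ℝ)
    (S : Matrix (Fin m) (Fin k) ℝ) (V : Matrix (Fin k) (Fin k) ℝ) : Prop :=
  Uᵀ * U = 1 ∧ Vᵀ * V = 1 ∧ A = U * S * Vᵀ ∧
  (∀ (i : Fin m) (j : Fin k), (i : ℕ) ≠ (j : ℕ) → S i j = 0) ∧
  (∀ i j, 0 ≤ S i j) ∧
  (∀ (a b : ℕ) (ham : a < m) (hak : a < k) (hbm : b < m) (hbk : b < k),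
    a ≤ b → S ⟨b, hbm⟩ ⟨b, hbk⟩ ≤ S ⟨a, ham⟩ ⟨a, hak⟩)

/-- `Ur` consists of the first `r` left singular vectors of `A`. -/
def IsLeftSingTrunc {m k : ℕ} (A : Matrix (Fin m) (Fin k) ℝ) (r : ℕ)
    (Ur : Matrix (Fin m) (Fin r) ℝ) : Prop :=
  ∃ U S V, IsSVD A U S V ∧ ∃ h : r ≤ m, ∀ (i : Fin m) (j : Fin r),
    Ur i j = U i ⟨(j : ℕ), lt_of_lt_of_le j.isLt h⟩

/-- `Vr` consists of the first `r` right singular vectors of `A`. -/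
def IsRightSingTrunc {m k : ℕ} (A : Matrix (Fin m) (Fin k) ℝ) (r : ℕ)
    (Vr : Matrix (Fin k) (Fin r) ℝ) : Prop :=
  IsLeftSingTrunc Aᵀ r Vr

/-- The matrix (I − EEᵀ)(FFᵀ), whose spectral/Frobenius norm is the sinΘ distance
between the column spaces of `E` and `F` (for `E`, `F` with orthonormal columns). -/
def sinThetaMat {k r : ℕ} (E F : Matrix (Fin k) (Fin r) ℝ) : Matrix (Fin k) (Fin k) ℝ :=
  (1 - E * Eᵀ) * (F * Fᵀ)

/-- Membership matrix: each row has exactly one entry 1 and all others 0. -/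
def IsMembership {k r : ℕ} (M : Matrix (Fin k) (Fin r) ℝ) : Prop :=
  ∀ i, ∃ j, M i j = 1 ∧ ∀ j', j' ≠ j → M i j' = 0

/-- A family of finsets forming a partition of `Fin k`. -/
def IsPartition {k r : ℕ} (Ω : Fin r → Finset (Fin k)) : Prop :=
  (∀ a b, a ≠ b → Disjoint (Ω a) (Ω b)) ∧ Finset.univ.biUnion Ω = Finset.univ

/-- `P` is aggregatable w.r.t. partition `Ω`: rows within the same cluster coincide. -/
def Aggregatable {k r : ℕ} (P : Matrix (Fin k) (Fin k) ℝ) (Ω : Fin r → Finset (Fin k)) : Prop :=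
  ∀ s, ∀ i ∈ Ω s, ∀ j ∈ Ω s, ∀ c, P i c = P j c

/-- Misclustering rate: min over bijections of the relative misclustering counts. -/
def MR {k r : ℕ} (Ω Ωh : Fin r → Finset (Fin k)) : ℝ :=
  ⨅ σ : Equiv.Perm (Fin r), ∑ j, (((Ω j) \ (Ωh (σ j))).card : ℝ) / ((Ω j).card : ℝ)

/-- k-means objective on the rows of `U`. -/
def kmeansObj {k r : ℕ} (U : Matrix (Fin k) (Fin r) ℝ) (Ωh : Fin r → Finset (Fin k))
    (c : Fin r → Fin r → ℝ) : ℝ :=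
  ∑ s, ∑ i ∈ Ωh s, ∑ j, (U i j - c s j) ^ 2

/-- Optimal value of the k-means problem on the rows of `U`. -/
def kmeansOpt {k r : ℕ} (U : Matrix (Fin k) (Fin r) ℝ) : ℝ :=
  sInf {v : ℝ | ∃ Ωh c, IsPartition Ωh ∧ v = kmeansObj U Ωh c}

/-- A (1+ε) approximate solution of the k-means problem on the rows of `U`. -/
def IsApproxKMeans {k r : ℕ} (U : Matrix (Fin k) (Fin r) ℝ) (ε : ℝ)
    (Ωh : Fin r → Finset (Fin k)) (c : Fin r → Fin r → ℝ) : Prop :=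
  IsPartition Ωh ∧ kmeansObj U Ωh c ≤ (1 + ε) * kmeansOpt U

/-- Optimal value of the k-means problem in membership-matrix form. -/
def kmeansOptM {k r : ℕ} (U : Matrix (Fin k) (Fin r) ℝ) : ℝ :=
  sInf {v : ℝ | ∃ (M : Matrix (Fin k) (Fin r) ℝ) (C : Matrix (Fin r) (Fin r) ℝ),
    IsMembership M ∧ v = frob (M * C - U) ^ 2}

/-- Number of t ∈ {1,…,N} with x_{t−1} = i. -/
def countState {k N : ℕ} (x : Fin (N+1) → Fin k) (i : Fin k) : ℕ :=
  (Finset.univ.filter fun t : Fin N => x t.castSucc = i).card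

/-- Number of t ∈ {1,…,N} with x_{t−1} = i and x_t = j. -/
def countTrans {k N : ℕ} (x : Fin (N+1) → Fin k) (i j : Fin k) : ℕ :=
  (Finset.univ.filter fun t : Fin N => x t.castSucc = i ∧ x t.succ = j).card

/-- Empirical state distribution. -/
def empPi {k N : ℕ} (x : Fin (N+1) → Fin k) (i : Fin k) : ℝ :=
  (countState x i : ℝ) / (N : ℝ)

/-- Empirical frequency matrix. -/
def empF {k N : ℕ} (x : Fin (N+1) → Fin k) : Matrix (Fin k) (Fin k) ℝ :=
  Matrix.of fun i j => (countTrans x i j : ℝ) / (N : ℝ)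

/-- Empirical transition matrix (uniform row if a state never occurs). -/
def empMatrix {k N : ℕ} (x : Fin (N+1) → Fin k) : Matrix (Fin k) (Fin k) ℝ :=
  Matrix.of fun i j =>
    if countState x i = 0 then 1 / (k : ℝ)
    else (countTrans x i j : ℝ) / (countState x i : ℝ)

/-- Probability weight of a finite Markov-chain path with initial distribution `pi0`. -/
def pathWeight {k : ℕ} (N : ℕ) (P : Matrix (Fin k) (Fin k) ℝ) (pi0 : Fin k → ℝ)
    (x : Fin (N+1) → Fin k) : ℝ :=
  pi0 (x 0) * ∏ t : Fin N, P (x t.castSucc) (x t.succ)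

/-- Probability of an event over Markov-chain trajectories of length N+1. -/
def pathProb {k : ℕ} (N : ℕ) (P : Matrix (Fin k) (Fin k) ℝ) (pi0 : Fin k → ℝ)
    (E : Set ((Fin (N+1)) → Fin k)) : ℝ :=
  ∑ x : Fin (N+1) → Fin k, E.indicator (pathWeight N P pi0) x

end MJ

namespace MJH

section Trotter

set_option linter.unusedSectionVars false

variable {A : Type*} [NormedRing A] [NormOneClass A] [NormedAlgebra ℝ A] [CompleteSpace A]

lemma pow_sub_pow_norm_le (X Z : A) (b : ℝ) (hb : 1 ≤ b) (hX : ‖X‖ ≤ b) (hZ : ‖Z‖ ≤ b) (k : ℕ) :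
    ‖X ^ k - Z ^ k‖ ≤ k * b ^ k * ‖X - Z‖ := by
  induction k with
  | zero => simp
  | succ k ih =>
    have h1 : X ^ (k+1) - Z ^ (k+1) = X ^ k * (X - Z) + (X ^ k - Z ^ k) * Z := by
      rw [pow_succ, pow_succ]; noncomm_ring
    have hXk : ‖X ^ k‖ ≤ b ^ k := (norm_pow_le X k).trans (pow_le_pow_left₀ (norm_nonneg _) hX k)
    have hb0 : 0 ≤ b := by linarith
    calc ‖X ^ (k+1) - Z ^ (k+1)‖ ≤ ‖X ^ k * (X - Z)‖ + ‖(X ^ k - Z ^ k) * Z‖ := by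
          rw [h1]; exact norm_add_le _ _
      _ ≤ ‖X ^ k‖ * ‖X - Z‖ + ‖X ^ k - Z ^ k‖ * ‖Z‖ := add_le_add (norm_mul_le _ _) (norm_mul_le _ _)
      _ ≤ b ^ k * ‖X - Z‖ + (k * b ^ k * ‖X - Z‖) * b := by gcongr
      _ ≤ b ^ (k+1) * ‖X - Z‖ + (k * b ^ k * ‖X - Z‖) * b := by
          gcongr
          · exact Nat.le_succ k
      _ = _ := by push_cast; ring

open Filter Topology Asymptotics in
lemma trotter (x y : A) :
    Tendsto (fun k : ℕ => (NormedSpace.exp ((k : ℝ)⁻¹ • x) * NormedSpace.exp ((k : ℝ)⁻¹ • y)) ^ k)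
      atTop (𝓝 (NormedSpace.exp (x + y))) := by
  let _ : NormedAlgebra ℚ A := NormedAlgebra.restrictScalars ℚ ℝ A
  have hd : ∀ z : A, HasDerivAt (fun s : ℝ => NormedSpace.exp (s • z)) z 0 := by
    intro z
    have := hasDerivAt_exp_smul_const (𝕂 := ℝ) z (0:ℝ)
    simpa using this
  have hX : HasDerivAt (fun s : ℝ => NormedSpace.exp (s • x) * NormedSpace.exp (s • y)) (x + y) 0 := by
    have := (hd x).mul (hd y)
    simp only [zero_smul, NormedSpace.exp_zero, mul_one, one_mul] at this
    exact this
  have hZ := hd (x + y)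
  have hD := hX.sub hZ
  have hinv : Tendsto (fun k : ℕ => (k : ℝ)⁻¹) atTop (𝓝 0) := tendsto_inv_atTop_nhds_zero_nat
  have hXO := (hX.isBigO_sub).comp_tendsto hinv
  have hZO := (hZ.isBigO_sub).comp_tendsto hinv
  have hDo := (hD.isLittleO).comp_tendsto hinv
  obtain ⟨C1, hC1⟩ := hXO.bound
  obtain ⟨C2, hC2⟩ := hZO.bound
  set C := max (max C1 C2) 0 with hC
  have hC0 : 0 ≤ C := le_max_right _ _
  rw [tendsto_iff_norm_sub_tendsto_zero]
  rw [Metric.tendsto_atTop]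
  intro e he
  have hpos : 0 < e / 2 / Real.exp C := by positivity
  have hDb := hDo.bound hpos
  obtain ⟨K, hK⟩ := eventually_atTop.1 (hC1.and (hC2.and (hDb.and (eventually_gt_atTop 0))))
  refine ⟨K, fun k hk => ?_⟩
  obtain ⟨h1, h2, h3, h0⟩ := hK k hk
  have hk0 : (0:ℝ) < k := by exact_mod_cast h0
  simp only [Function.comp, zero_smul, NormedSpace.exp_zero, sub_zero, mul_one, Pi.sub_apply,
    smul_zero, sub_self, norm_inv, RCLike.norm_natCast] at h1 h2 h3
  set X := NormedSpace.exp ((k : ℝ)⁻¹ • x) * NormedSpace.exp ((k : ℝ)⁻¹ • y) with hXd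
  set Z := NormedSpace.exp ((k : ℝ)⁻¹ • (x + y)) with hZd
  have hZk : Z ^ k = NormedSpace.exp (x + y) := by
    have := NormedSpace.exp_nsmul (𝔸 := A) k ((k : ℝ)⁻¹ • (x + y))
    rw [← this, ← Nat.cast_smul_eq_nsmul ℝ, smul_smul, mul_inv_cancel₀ hk0.ne', one_smul]
  have hb1 : (1:ℝ) ≤ 1 + C / k := by
    have : 0 ≤ C / k := by positivity
    linarith
  have aux : ∀ W : A, ∀ c, c ≤ C → ‖W - 1‖ ≤ c * (k:ℝ)⁻¹ → ‖W‖ ≤ 1 + C / k := by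
    intro W c hc hW
    have : ‖W‖ ≤ ‖W - 1‖ + ‖(1:A)‖ := by simpa using norm_add_le (W - 1) 1
    rw [norm_one] at this
    have h' : c * (k:ℝ)⁻¹ ≤ C / k := by rw [div_eq_mul_inv]; gcongr
    linarith
  have hXn := aux X C1 ((le_max_left _ _).trans (le_max_left _ _)) h1
  have hZn := aux Z C2 ((le_max_right _ _).trans (le_max_left _ _)) h2
  have hmain := pow_sub_pow_norm_le X Z _ hb1 hXn hZn k
  have hexp : (1 + C / k) ^ k ≤ Real.exp C := by
    calc (1 + C / k) ^ k ≤ (Real.exp (C / k)) ^ k := by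
          apply pow_le_pow_left₀ (by linarith)
          linarith [Real.add_one_le_exp (C / k)]
      _ = Real.exp C := by rw [← Real.exp_nat_mul]; congr 1; field_simp
  rw [hZk] at hmain
  rw [Real.dist_eq, sub_zero, abs_of_nonneg (norm_nonneg _)]
  have h4 : ‖X - Z‖ ≤ e / 2 / Real.exp C * (k:ℝ)⁻¹ := by
    simpa using h3
  calc _ ≤ k * (1 + C / k) ^ k * ‖X - Z‖ := hmain
    _ ≤ k * Real.exp C * (e / 2 / Real.exp C * (k:ℝ)⁻¹) := by gcongr
    _ = e / 2 := by field_simp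
    _ < e := by linarith

end Trotter

section GT

set_option linter.unusedSectionVars false

variable {ι : Type*} [Fintype ι] [DecidableEq ι]

lemma trace_cs (X Y : Matrix ι ι ℝ) :
    (X * Y).trace ^ 2 ≤ (X * Xᵀ).trace * (Yᵀ * Y).trace := by
  have e1 : (X * Y).trace = ∑ p : ι × ι, X p.1 p.2 * Y p.2 p.1 := by
    simp [Matrix.trace, Matrix.mul_apply, Fintype.sum_prod_type]
  have e2 : (X * Xᵀ).trace = ∑ p : ι × ι, X p.1 p.2 ^ 2 := by
    simp [Matrix.trace, Matrix.mul_apply, Fintype.sum_prod_type, sq]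
  have e3 : (Yᵀ * Y).trace = ∑ p : ι × ι, Y p.2 p.1 ^ 2 := by
    simp [Matrix.trace, Matrix.mul_apply, Fintype.sum_prod_type, sq]
  rw [e1, e2, e3]
  exact Finset.sum_mul_sq_le_sq_mul_sq _ _ _

lemma trace_mul_transpose_nonneg (X : Matrix ι ι ℝ) : 0 ≤ (X * Xᵀ).trace := by
  simp only [Matrix.trace, Matrix.diag, Matrix.mul_apply, Matrix.transpose_apply]
  exact Finset.sum_nonneg fun i _ => Finset.sum_nonneg fun j _ => mul_self_nonneg _

lemma cyc (X Y : Matrix ι ι ℝ) (m : ℕ) : ((X * Y) ^ m).trace = ((Y * X) ^ m).trace := by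
  cases m with
  | zero => simp
  | succ m =>
    have : (X * Y) ^ (m+1) = X * ((Y * X) ^ m * Y) := by
      have h : ∀ m : ℕ, (X * Y) ^ m * X = X * (Y * X) ^ m := by
        intro m
        induction m with
        | zero => simp
        | succ m ih => rw [pow_succ', mul_assoc, ih, pow_succ']; simp only [mul_assoc]
      rw [pow_succ, ← mul_assoc, h]; simp only [mul_assoc]
    rw [this, Matrix.trace_mul_comm, mul_assoc, ← pow_succ]

lemma ST (j : ℕ) : (∀ Z : Matrix ι ι ℝ, |(Z ^ (2 ^ (j+1))).trace| ≤ ((Z * Zᵀ) ^ (2 ^ j)).trace) ∧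
    (∀ X Y : Matrix ι ι ℝ, Xᵀ = X → Yᵀ = Y →
      ((X * Y) ^ (2 ^ j)).trace ≤ (X ^ (2 ^ j) * Y ^ (2 ^ j)).trace) := by
  induction j with
  | zero =>
    refine ⟨fun Z => ?_, fun X Y _ _ => by simp⟩
    have h := trace_cs Z Z
    rw [Matrix.trace_mul_comm Zᵀ Z, ← sq] at h
    simp only [zero_add, pow_one, pow_zero, ← sq] at *
    exact abs_le_of_sq_le_sq h (by have := trace_mul_transpose_nonneg Z; simpa using this)
  | succ j ih =>
    obtain ⟨hS, hT⟩ := ih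
    constructor
    · intro Z
      have h1 := hS (Z ^ 2)
      rw [← pow_mul, ← pow_succ'] at h1
      refine h1.trans ?_
      have h2 : ((Z ^ 2 * (Z ^ 2)ᵀ) ^ (2 ^ j)).trace = (((Zᵀ * Z) * (Z * Zᵀ)) ^ (2 ^ j)).trace := by
        have : Z ^ 2 * (Z ^ 2)ᵀ = (Z * Z * Zᵀ) * Zᵀ := by
          rw [sq, Matrix.transpose_mul]; simp only [mul_assoc]
        rw [this, cyc]; simp only [mul_assoc]
      rw [h2]
      have s1 : (Zᵀ * Z)ᵀ = Zᵀ * Z := by simp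
      have s2 : (Z * Zᵀ)ᵀ = Z * Zᵀ := by simp
      refine (hT _ _ s1 s2).trans ?_
      have h3 := trace_cs ((Zᵀ * Z) ^ (2 ^ j)) ((Z * Zᵀ) ^ (2 ^ j))
      rw [Matrix.transpose_pow, Matrix.transpose_pow, s1, s2, ← pow_add, ← pow_add, ← two_mul,
        ← pow_succ', cyc Zᵀ Z, ← sq] at h3
      refine (le_abs_self _).trans (abs_le_of_sq_le_sq h3 ?_)
      have := trace_mul_transpose_nonneg ((Z * Zᵀ) ^ (2 ^ j))
      rwa [Matrix.transpose_pow, s2, ← pow_add, ← two_mul, ← pow_succ'] at this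
    · intro X Y hX hY
      have h1 := (le_abs_self _).trans (hS (X * Y))
      refine h1.trans ?_
      have h2 : ((X * Y * (X * Y)ᵀ) ^ (2 ^ j)).trace = ((X ^ 2 * Y ^ 2) ^ (2 ^ j)).trace := by
        have : X * Y * (X * Y)ᵀ = (X * Y ^ 2) * X := by
          rw [Matrix.transpose_mul, hX, hY, sq]; simp only [mul_assoc]
        rw [this, cyc]; simp only [mul_assoc, sq]
      rw [h2]
      refine (hT _ _ (by rw [Matrix.transpose_pow, hX]) (by rw [Matrix.transpose_pow, hY])).trans ?_
      rw [← pow_mul, ← pow_mul, ← pow_succ']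

open Filter Topology in
open scoped Matrix.Norms.Operator in
lemma trotterM [Nonempty ι] (x y : Matrix ι ι ℝ) :
    Tendsto (fun k : ℕ => (NormedSpace.exp ((k : ℝ)⁻¹ • x) * NormedSpace.exp ((k : ℝ)⁻¹ • y)) ^ k)
      atTop (𝓝 (NormedSpace.exp (x + y))) := trotter x y

open Filter Topology in
/-- Golden–Thompson inequality for real symmetric matrices. -/
lemma golden_thompson [Nonempty ι] (X Y : Matrix ι ι ℝ) (hX : Xᵀ = X) (hY : Yᵀ = Y) :
    (NormedSpace.exp (X + Y)).trace ≤ (NormedSpace.exp X * NormedSpace.exp Y).trace := by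
  have h := (trotterM X Y).comp (tendsto_pow_atTop_atTop_of_one_lt (r := 2) (by norm_num))
  have h2 : Tendsto (fun A : Matrix ι ι ℝ => A.trace) (𝓝 (NormedSpace.exp (X + Y)))
      (𝓝 ((NormedSpace.exp (X + Y)).trace)) :=
    (Continuous.matrix_trace continuous_id).tendsto _
  refine le_of_tendsto (h2.comp h) (Eventually.of_forall fun j => ?_)
  simp only [Function.comp]
  refine ((ST j).2 _ _ ?_ ?_).trans ?_
  · rw [← Matrix.exp_transpose, Matrix.transpose_smul, hX]
  · rw [← Matrix.exp_transpose, Matrix.transpose_smul, hY]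
  · have : ∀ W : Matrix ι ι ℝ, NormedSpace.exp (((2 ^ j : ℕ) : ℝ)⁻¹ • W) ^ (2 ^ j) = NormedSpace.exp W := by
      intro W
      rw [← Matrix.exp_nsmul, ← Nat.cast_smul_eq_nsmul ℝ, smul_smul, mul_inv_cancel₀, one_smul]
      positivity
    rw [this, this]

/-- spectral decomposition in elementary form -/
lemma spectral (X : Matrix ι ι ℝ) (hX : Xᵀ = X) :
    ∃ (U : Matrix ι ι ℝ) (d : ι → ℝ), U * Uᵀ = 1 ∧ Uᵀ * U = 1 ∧ X = U * Matrix.diagonal d * Uᵀ := by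
  have hH : X.IsHermitian := by
    unfold Matrix.IsHermitian
    rw [Matrix.conjTranspose_eq_transpose_of_trivial, hX]
  refine ⟨hH.eigenvectorUnitary, hH.eigenvalues, ?_, ?_, ?_⟩
  · have := Unitary.coe_mul_star_self hH.eigenvectorUnitary
    rwa [Unitary.coe_star, Matrix.star_eq_conjTranspose, Matrix.conjTranspose_eq_transpose_of_trivial] at this
  · have := Unitary.coe_star_mul_self hH.eigenvectorUnitary
    rwa [Matrix.star_eq_conjTranspose, Matrix.conjTranspose_eq_transpose_of_trivial] at this
  · have := hH.spectral_theorem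
    rw [Unitary.conjStarAlgAut_apply, Matrix.star_eq_conjTranspose,
      Matrix.conjTranspose_eq_transpose_of_trivial] at this
    exact this

lemma exp_spectral (U : Matrix ι ι ℝ) (d : ι → ℝ) (h1 : U * Uᵀ = 1) :
    NormedSpace.exp (U * Matrix.diagonal d * Uᵀ) =
      U * Matrix.diagonal (fun i => Real.exp (d i)) * Uᵀ := by
  have hinv : U⁻¹ = Uᵀ := Matrix.inv_eq_right_inv h1
  have hU : IsUnit U := by
    rw [Matrix.isUnit_iff_isUnit_det]
    exact Matrix.isUnit_det_of_right_inverse h1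
  rw [← hinv, Matrix.exp_conj _ _ hU, Matrix.exp_diagonal]
  congr 3
  ext i
  rw [Pi.coe_exp]
  simp [Real.exp_eq_exp_ℝ]

end GT
end MJH
namespace MJH

section Spec

set_option linter.unusedSectionVars false

variable {ι : Type*} [Fintype ι] [DecidableEq ι]

lemma quad_spectral (U : Matrix ι ι ℝ) (d u : ι → ℝ) :
    u ⬝ᵥ ((U * Matrix.diagonal d * Uᵀ) *ᵥ u) = ∑ i, d i * (Uᵀ *ᵥ u) i ^ 2 := by
  rw [← Matrix.mulVec_mulVec, ← Matrix.mulVec_mulVec, Matrix.dotProduct_mulVec,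
    ← Matrix.mulVec_transpose, dotProduct]
  refine Finset.sum_congr rfl fun i _ => ?_
  rw [Matrix.mulVec_diagonal]; ring

lemma norm_spectral (U : Matrix ι ι ℝ) (h1 : U * Uᵀ = 1) (u : ι → ℝ) :
    ∑ i, (Uᵀ *ᵥ u) i ^ 2 = ∑ i, u i ^ 2 := by
  have := quad_spectral U (fun _ => 1) u
  rw [Matrix.diagonal_one, mul_one, h1, Matrix.one_mulVec] at this
  simp only [one_mul] at this
  rw [← this, dotProduct]
  exact Finset.sum_congr rfl fun i _ => by ring

lemma trace_conj (U : Matrix ι ι ℝ) (G : Matrix ι ι ℝ) (f : ι → ℝ) :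
    (G * (U * Matrix.diagonal f * Uᵀ)).trace = ∑ i, f i * ((Uᵀ * G * U) i i) := by
  have : (G * (U * Matrix.diagonal f * Uᵀ)).trace = ((Uᵀ * G * U) * Matrix.diagonal f).trace := by
    rw [← mul_assoc, Matrix.trace_mul_comm]; simp only [mul_assoc]
  rw [this, Matrix.trace]
  refine Finset.sum_congr rfl fun i _ => ?_
  rw [Matrix.diag_apply, Matrix.mul_diagonal]; ring

lemma trace_exp_quad (S : Matrix ι ι ℝ) (hS : Sᵀ = S) (c : ℝ)
    (h : (NormedSpace.exp S).trace < Real.exp c) (u : ι → ℝ) :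
    u ⬝ᵥ (S *ᵥ u) ≤ c * ∑ i, u i ^ 2 := by
  obtain ⟨U, d, h1, h2, rfl⟩ := spectral S hS
  rw [exp_spectral U d h1] at h
  have ht := trace_conj U 1 (fun i => Real.exp (d i))
  simp only [one_mul, mul_one, h2, Matrix.one_apply_eq] at ht
  rw [ht] at h
  rw [quad_spectral, ← norm_spectral U h1, Finset.mul_sum]
  refine Finset.sum_le_sum fun i _ => mul_le_mul_of_nonneg_right ?_ (sq_nonneg _)
  have : Real.exp (d i) ≤ ∑ i, Real.exp (d i) :=
    Finset.single_le_sum (f := fun i => Real.exp (d i)) (fun i _ => (Real.exp_pos _).le) (Finset.mem_univ i)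
  exact (Real.exp_lt_exp.1 (this.trans_lt h)).le

lemma exp_psd (S : Matrix ι ι ℝ) (hS : Sᵀ = S) (u : ι → ℝ) :
    0 ≤ u ⬝ᵥ (NormedSpace.exp S *ᵥ u) := by
  obtain ⟨U, d, h1, h2, rfl⟩ := spectral S hS
  rw [exp_spectral U d h1, quad_spectral]
  exact Finset.sum_nonneg fun i _ => mul_nonneg (Real.exp_pos _).le (sq_nonneg _)

lemma exp_trace_nonneg (S : Matrix ι ι ℝ) (hS : Sᵀ = S) : 0 ≤ (NormedSpace.exp S).trace := by
  refine Finset.sum_nonneg fun i _ => ?_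
  have := exp_psd S hS (Pi.single i 1)
  simpa using this

lemma trace_mul_exp_le (G Y : Matrix ι ι ℝ) (hG : ∀ u : ι → ℝ, 0 ≤ u ⬝ᵥ (G *ᵥ u)) (hY : Yᵀ = Y)
    (h : (Y * Y).trace ≤ 1) :
    (G * NormedSpace.exp Y).trace ≤ G.trace + (G * Y).trace + (G * (Y * Y)).trace := by
  obtain ⟨U, d, h1, h2, rfl⟩ := spectral Y hY
  have hsq : U * Matrix.diagonal d * Uᵀ * (U * Matrix.diagonal d * Uᵀ)
      = U * Matrix.diagonal (fun i => d i * d i) * Uᵀ := by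
    calc _ = U * Matrix.diagonal d * (Uᵀ * U) * Matrix.diagonal d * Uᵀ := by simp only [mul_assoc]
      _ = U * (Matrix.diagonal d * Matrix.diagonal d) * Uᵀ := by rw [h2]; simp only [mul_assoc, mul_one, one_mul]
      _ = _ := by rw [Matrix.diagonal_mul_diagonal]
  rw [hsq] at h ⊢
  have ht := trace_conj U 1 (fun i => d i * d i)
  simp only [one_mul, mul_one, h2, Matrix.one_apply_eq] at ht
  rw [ht] at h
  have h0 := trace_conj U G (fun _ => 1)
  rw [Matrix.diagonal_one, mul_one, h1, mul_one] at h0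
  rw [exp_spectral U d h1, trace_conj, trace_conj, trace_conj, h0, ← Finset.sum_add_distrib,
    ← Finset.sum_add_distrib]
  refine Finset.sum_le_sum fun i _ => ?_
  have hg : 0 ≤ (Uᵀ * G * U) i i := by
    have := hG (U.col i)
    convert this using 1
    rw [mul_assoc, Matrix.mul_apply, dotProduct]
    refine Finset.sum_congr rfl fun k _ => ?_
    simp [Matrix.mulVec, Matrix.mul_apply, dotProduct, Matrix.col]
  have hd : d i * d i ≤ 1 := (Finset.single_le_sum (f := fun i => d i * d i)
    (fun i _ => mul_self_nonneg _) (Finset.mem_univ i)).trans h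
  have hd' : |d i| ≤ 1 := by
    rw [← sq_le_one_iff_abs_le_one]; nlinarith
  have he := (abs_le.1 (Real.abs_exp_sub_one_sub_id_le hd')).2
  nlinarith
end Spec

section Step

variable {n : ℕ}

/-- one step increment, symmetric dilation -/
def Bm (P : Matrix (Fin n) (Fin n) ℝ) (i j : Fin n) : Matrix (Fin n) (Fin n) ℝ :=
  Matrix.of fun a b => (if a = i then 1 else 0) * ((if b = j then 1 else 0) - P i b)

def Ym (P : Matrix (Fin n) (Fin n) ℝ) (i j : Fin n) : Matrix (Fin n ⊕ Fin n) (Fin n ⊕ Fin n) ℝ :=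
  Matrix.fromBlocks 0 (Bm P i j) (Bm P i j)ᵀ 0

lemma Ym_symm (P : Matrix (Fin n) (Fin n) ℝ) (i j : Fin n) : (Ym P i j)ᵀ = Ym P i j := by
  simp [Ym, Matrix.fromBlocks_transpose]

lemma trace_G_Ym (P : Matrix (Fin n) (Fin n) ℝ) (i j : Fin n)
    (G : Matrix (Fin n ⊕ Fin n) (Fin n ⊕ Fin n) ℝ) :
    (G * Ym P i j).trace = ∑ k, (G (.inl i) (.inr k) + G (.inr k) (.inl i)) *
      ((if k = j then 1 else 0) - P i k) := by
  simp only [Matrix.trace, Matrix.diag, Matrix.mul_apply, Fintype.sum_sum_type, Ym,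
    Matrix.fromBlocks_apply₁₁, Matrix.fromBlocks_apply₁₂, Matrix.fromBlocks_apply₂₁,
    Matrix.fromBlocks_apply₂₂, Matrix.zero_apply, mul_zero, Finset.sum_const_zero, zero_add, add_zero,
    Matrix.transpose_apply, Bm, Matrix.of_apply]
  simp only [add_mul, Finset.sum_add_distrib]
  congr 1
  · rw [Finset.sum_eq_single i (by intro b _ hb; simp [hb]) (by simp)]
    simp
  · refine Finset.sum_congr rfl fun k _ => ?_
    rw [Finset.sum_eq_single i (by intro b _ hb; simp [hb]) (by simp)]
    simp

lemma Ym_sq (P : Matrix (Fin n) (Fin n) ℝ) (i j : Fin n) :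
    Ym P i j * Ym P i j = Matrix.fromBlocks (Bm P i j * (Bm P i j)ᵀ) 0 0 ((Bm P i j)ᵀ * Bm P i j) := by
  simp [Ym, Matrix.fromBlocks_multiply]

lemma BBt (P : Matrix (Fin n) (Fin n) ℝ) (i j a b : Fin n) : (Bm P i j * (Bm P i j)ᵀ) a b =
    (if a = i then 1 else 0) * (if b = i then 1 else 0) * ∑ k, ((if k = j then 1 else 0) - P i k)^2 := by
  simp only [Matrix.mul_apply, Bm, Matrix.transpose_apply, Matrix.of_apply, Finset.mul_sum]
  exact Finset.sum_congr rfl fun k _ => by ring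

lemma BtB (P : Matrix (Fin n) (Fin n) ℝ) (i j a b : Fin n) : ((Bm P i j)ᵀ * (Bm P i j)) a b =
    ((if a = j then 1 else 0) - P i a) * ((if b = j then 1 else 0) - P i b) := by
  simp only [Matrix.mul_apply, Bm, Matrix.transpose_apply, Matrix.of_apply]
  rw [Finset.sum_eq_single i (by intro b _ hb; simp [hb]) (by simp)]
  simp

lemma trace_G_Ym_sq (P : Matrix (Fin n) (Fin n) ℝ) (i j : Fin n)
    (G : Matrix (Fin n ⊕ Fin n) (Fin n ⊕ Fin n) ℝ) :
    (G * (Ym P i j * Ym P i j)).trace = G (.inl i) (.inl i) * (∑ k, ((if k = j then 1 else 0) - P i k)^2)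
      + ∑ k, ∑ l, G (.inr k) (.inr l) * (((if l = j then 1 else 0) - P i l) * ((if k = j then 1 else 0) - P i k)) := by
  rw [Ym_sq]
  simp only [Matrix.trace, Matrix.diag, Matrix.mul_apply (M := G), Fintype.sum_sum_type,
    Matrix.fromBlocks_apply₁₁, Matrix.fromBlocks_apply₁₂, Matrix.fromBlocks_apply₂₁,
    Matrix.fromBlocks_apply₂₂, Matrix.zero_apply, mul_zero, Finset.sum_const_zero, zero_add, add_zero,
    BBt, BtB]
  congr 1
  rw [Finset.sum_eq_single i (by intro b _ hb; simp [hb]) (by simp)]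
  rw [Finset.sum_eq_single i (by intro b _ hb; simp [hb]) (by simp)]
  simp

lemma sum_sq_w (p : Fin n → ℝ) (j : Fin n) :
    ∑ k, ((if k = j then 1 else 0) - p k)^2 = 1 - 2 * p j + ∑ k, p k ^ 2 := by
  have : ∀ k, ((if k = j then (1:ℝ) else 0) - p k)^2
      = (if k = j then 1 - 2 * p k else 0) + p k ^ 2 := by
    intro k; split_ifs <;> ring
  simp only [this, Finset.sum_add_distrib, Finset.sum_ite_eq', Finset.mem_univ, if_true]

lemma step (P : Matrix (Fin n) (Fin n) ℝ) (hn : 0 < n) (hP : MJ.RowStochastic P)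
    (A : Matrix (Fin n ⊕ Fin n) (Fin n ⊕ Fin n) ℝ) (hA : Aᵀ = A) (μ : Fin n → ℝ)
    (hμ0 : ∀ i, 0 ≤ μ i) (hμ1 : ∑ i, μ i = 1)
    (v : ℝ) (hv1 : ∀ i, μ i ≤ v) (hv2 : ∀ j, ∑ i, μ i * P i j ≤ v) (θ : ℝ) (hθ : 4 * θ ^ 2 ≤ 1) :
    ∑ i, μ i * ∑ j, P i j * (NormedSpace.exp (A + θ • Ym P i j)).trace ≤
      (1 + θ ^ 2 * v) * (NormedSpace.exp A).trace := by
  obtain ⟨hP0, hP1⟩ := hP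
  have : Nonempty (Fin n ⊕ Fin n) := ⟨.inl ⟨0, hn⟩⟩
  set G := NormedSpace.exp A with hG
  have hpsd : ∀ u, 0 ≤ u ⬝ᵥ (G *ᵥ u) := exp_psd A hA
  have hdiag : ∀ a, 0 ≤ G a a := by
    intro a
    have := hpsd (Pi.single a 1)
    simpa using this
  have hsq1 : ∀ i, ∑ k, P i k ^ 2 ≤ 1 := by
    intro i
    rw [← hP1 i]
    refine Finset.sum_le_sum fun k _ => ?_
    have : P i k ≤ 1 := by
      rw [← hP1 i]; exact Finset.single_le_sum (fun k _ => hP0 i k) (Finset.mem_univ k)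
    nlinarith [hP0 i k]
  have h1 : ∀ i j, (NormedSpace.exp (A + θ • Ym P i j)).trace ≤
      G.trace + θ * (G * Ym P i j).trace + θ ^ 2 * (G * (Ym P i j * Ym P i j)).trace := by
    intro i j
    have hs : (θ • Ym P i j)ᵀ = θ • Ym P i j := by rw [Matrix.transpose_smul, Ym_symm]
    refine (golden_thompson A (θ • Ym P i j) hA hs).trans ?_
    refine (trace_mul_exp_le G (θ • Ym P i j) hpsd hs ?_).trans (le_of_eq ?_)
    · have := trace_G_Ym_sq P i j 1
      rw [one_mul] at this
      rw [Matrix.smul_mul, Matrix.mul_smul, smul_smul, Matrix.trace_smul, this]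
      have h2 : ∀ k, ∑ l, (1 : Matrix (Fin n ⊕ Fin n) (Fin n ⊕ Fin n) ℝ) (.inr k) (.inr l) *
          (((if l = j then 1 else 0) - P i l) * ((if k = j then 1 else 0) - P i k))
          = ((if k = j then 1 else 0) - P i k)^2 := by
        intro k
        rw [Finset.sum_eq_single k (by intro b _ hb; simp [Ne.symm hb]) (by simp)]
        simp; ring
      simp only [h2, sum_sq_w, Matrix.one_apply_eq]
      have := hsq1 i
      have := hP0 i j
      have hq : 0 ≤ ∑ k, P i k ^ 2 := Finset.sum_nonneg fun k _ => sq_nonneg _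
      simp only [smul_eq_mul]
      nlinarith [sq_nonneg θ]
    · simp only [Matrix.mul_smul, Matrix.smul_mul, Matrix.trace_smul, smul_eq_mul]; ring
  have hlin : ∀ i, ∑ j, P i j * (G * Ym P i j).trace = 0 := by
    intro i
    simp only [trace_G_Ym, Finset.mul_sum]
    rw [Finset.sum_comm]
    refine Finset.sum_eq_zero fun k _ => ?_
    have : ∀ j, P i j * ((G (.inl i) (.inr k) + G (.inr k) (.inl i)) *
      ((if k = j then 1 else 0) - P i k)) = (G (.inl i) (.inr k) + G (.inr k) (.inl i)) *
       ((if k = j then P i j else 0) - P i j * P i k) := by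
      intro j; split_ifs <;> ring
    simp only [this, ← Finset.mul_sum, Finset.sum_sub_distrib, ← Finset.sum_mul, hP1,
      Finset.sum_ite_eq, Finset.mem_univ, if_true]
    ring
  have hquad : ∀ i, ∑ j, P i j * (G * (Ym P i j * Ym P i j)).trace ≤
      G (.inl i) (.inl i) + ∑ k, P i k * G (.inr k) (.inr k) := by
    intro i
    simp only [trace_G_Ym_sq, mul_add, Finset.sum_add_distrib]
    refine add_le_add ?_ ?_
    · have : ∀ j, P i j * (G (.inl i) (.inl i) * (∑ k, ((if k = j then 1 else 0) - P i k)^2))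
        = G (.inl i) (.inl i) * (P i j - 2 * P i j ^ 2 + P i j * ∑ k, P i k ^ 2) := by
        intro j; rw [sum_sq_w]; ring
      simp only [this, ← Finset.mul_sum, Finset.sum_add_distrib, Finset.sum_sub_distrib,
        ← Finset.sum_mul, hP1]
      have hq : 0 ≤ ∑ k, P i k ^ 2 := Finset.sum_nonneg fun k _ => sq_nonneg _
      nlinarith [hdiag (.inl i)]
    · have e1 : ∀ k l, ∑ j, P i j * (G (.inr k) (.inr l) * (((if l = j then 1 else 0) - P i l) *
          ((if k = j then 1 else 0) - P i k))) =
          (if k = l then P i k * G (.inr k) (.inr l) else 0) - P i k * P i l * G (.inr k) (.inr l) := by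
        intro k l
        have : ∀ j, P i j * (G (.inr k) (.inr l) * (((if l = j then 1 else 0) - P i l) *
          ((if k = j then 1 else 0) - P i k))) =
          G (.inr k) (.inr l) * ((if k = j then (if l = j then P i j else 0) else 0)
            - (if k = j then P i j * P i l else 0)
            - (if l = j then P i j * P i k else 0) + P i j * (P i l * P i k)) := by
          intro j; split_ifs <;> ring
        simp only [this, ← Finset.mul_sum, Finset.sum_add_distrib, Finset.sum_sub_distrib,
          ← Finset.sum_mul, hP1, Finset.sum_ite_eq, Finset.mem_univ, if_true]
        by_cases hkl : k = l
        · subst hkl; simp; ring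
        · simp [hkl, Ne.symm hkl]; ring
      have e2 : ∑ j, P i j * ∑ k, ∑ l, G (.inr k) (.inr l) * (((if l = j then 1 else 0) - P i l) *
          ((if k = j then 1 else 0) - P i k)) =
          ∑ k, ∑ l, ∑ j, P i j * (G (.inr k) (.inr l) * (((if l = j then 1 else 0) - P i l) *
          ((if k = j then 1 else 0) - P i k))) := by
        simp only [Finset.mul_sum]
        rw [Finset.sum_comm]
        refine Finset.sum_congr rfl fun k _ => ?_
        rw [Finset.sum_comm]
      rw [e2]
      simp only [e1, Finset.sum_sub_distrib, Finset.sum_ite_eq, Finset.mem_univ, if_true]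
      have := hpsd (Sum.elim (fun _ => 0) (P i))
      simp only [dotProduct, Matrix.mulVec, Fintype.sum_sum_type, Sum.elim_inl, Sum.elim_inr,
        zero_mul, mul_zero, Finset.sum_const_zero, zero_add, Finset.mul_sum] at this
      have e3 : ∑ k, ∑ l, P i k * P i l * G (.inr k) (.inr l) =
        ∑ k, ∑ l, P i k * (G (.inr k) (.inr l) * P i l) :=
        Finset.sum_congr rfl fun k _ => Finset.sum_congr rfl fun l _ => by ring
      rw [e3]; linarith
  have hmain : ∀ i, ∑ j, P i j * (NormedSpace.exp (A + θ • Ym P i j)).trace ≤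
      G.trace + θ ^ 2 * (G (.inl i) (.inl i) + ∑ k, P i k * G (.inr k) (.inr k)) := by
    intro i
    calc _ ≤ ∑ j, P i j * (G.trace + θ * (G * Ym P i j).trace + θ ^ 2 * (G * (Ym P i j * Ym P i j)).trace) :=
          Finset.sum_le_sum fun j _ => mul_le_mul_of_nonneg_left (h1 i j) (hP0 i j)
      _ = (∑ j, P i j) * G.trace + θ * (∑ j, P i j * (G * Ym P i j).trace) +
          θ ^ 2 * ∑ j, P i j * (G * (Ym P i j * Ym P i j)).trace := by
          rw [Finset.sum_mul, Finset.mul_sum, Finset.mul_sum, ← Finset.sum_add_distrib,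
            ← Finset.sum_add_distrib]
          exact Finset.sum_congr rfl fun j _ => by ring
      _ ≤ _ := by
          rw [hP1, hlin]
          have := mul_le_mul_of_nonneg_left (hquad i) (sq_nonneg θ)
          linarith
  calc _ ≤ ∑ i, μ i * (G.trace + θ ^ 2 * (G (.inl i) (.inl i) + ∑ k, P i k * G (.inr k) (.inr k))) :=
        Finset.sum_le_sum fun i _ => mul_le_mul_of_nonneg_left (hmain i) (hμ0 i)
    _ = G.trace + θ ^ 2 * (∑ i, μ i * G (.inl i) (.inl i) + ∑ k, (∑ i, μ i * P i k) * G (.inr k) (.inr k)) := by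
        have e4 : ∑ k, (∑ i, μ i * P i k) * G (.inr k) (.inr k)
            = ∑ i, μ i * ∑ k, P i k * G (.inr k) (.inr k) := by
          simp only [Finset.sum_mul, Finset.mul_sum]
          rw [Finset.sum_comm]
          exact Finset.sum_congr rfl fun i _ => Finset.sum_congr rfl fun k _ => by ring
        rw [e4, ← Finset.sum_add_distrib, Finset.mul_sum]
        have e5 : G.trace = ∑ i, μ i * G.trace := by rw [← Finset.sum_mul, hμ1, one_mul]
        rw [show ∀ q : ℝ, G.trace + q = (∑ i, μ i * G.trace) + q from fun q => by rw [← e5],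
          ← Finset.sum_add_distrib]
        exact Finset.sum_congr rfl fun i _ => by ring
    _ ≤ G.trace + θ ^ 2 * (∑ i, v * G (.inl i) (.inl i) + ∑ k, v * G (.inr k) (.inr k)) := by
        gcongr with i _ k _
        · exact hdiag _
        · exact hv1 i
        · exact hdiag _
        · exact hv2 k
    _ = _ := by
        have : G.trace = ∑ i, G (.inl i) (.inl i) + ∑ k, G (.inr k) (.inr k) := by
          simp [Matrix.trace, Fintype.sum_sum_type]
        rw [← Finset.mul_sum, ← Finset.mul_sum, this]; ring

end Step
end MJH
namespace MJH

section Path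

variable {n : ℕ}

/-- overwrite a path from time `m` on. -/
def upd (x : ℕ → Fin n) (m : ℕ) (j : Fin n) : ℕ → Fin n := fun t => if t < m then x t else j

/-- path expectation. -/
def EE (P : Matrix (Fin n) (Fin n) ℝ) (pi0 : Fin n → ℝ) : ℕ → ((ℕ → Fin n) → ℝ) → ℝ
  | 0, f => ∑ i, pi0 i * f (fun _ => i)
  | N+1, f => EE P pi0 N (fun x => ∑ j, P (x N) j * f (upd x (N+1) j))

/-- dependence on coordinates up to `m`. -/
def Dep (m : ℕ) (f : (ℕ → Fin n) → ℝ) : Prop := ∀ x y, (∀ t, t ≤ m → x t = y t) → f x = f y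

variable {P : Matrix (Fin n) (Fin n) ℝ} {pi0 : Fin n → ℝ}

lemma EE_mono (hP : MJ.RowStochastic P) (h0 : MJ.IsProbVec pi0) (N : ℕ) :
    ∀ f g : (ℕ → Fin n) → ℝ, (∀ x, f x ≤ g x) → EE P pi0 N f ≤ EE P pi0 N g := by
  induction N with
  | zero =>
    intro f g h
    exact Finset.sum_le_sum fun i _ => mul_le_mul_of_nonneg_left (h _) (h0.1 i)
  | succ N ih =>
    intro f g h
    exact ih _ _ fun x => Finset.sum_le_sum fun i _ => mul_le_mul_of_nonneg_left (h _) (hP.1 _ i)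

lemma EE_smul (c : ℝ) (N : ℕ) :
    ∀ f : (ℕ → Fin n) → ℝ, EE P pi0 N (fun x => c * f x) = c * EE P pi0 N f := by
  induction N with
  | zero =>
    intro f
    simp only [EE, Finset.mul_sum]
    exact Finset.sum_congr rfl fun i _ => by ring
  | succ N ih =>
    intro f
    simp only [EE]
    rw [← ih]
    congr 1; funext x
    rw [Finset.mul_sum]
    exact Finset.sum_congr rfl fun i _ => by ring

lemma EE_add (N : ℕ) :
    ∀ f g : (ℕ → Fin n) → ℝ, EE P pi0 N (fun x => f x + g x) = EE P pi0 N f + EE P pi0 N g := by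
  induction N with
  | zero =>
    intro f g
    simp only [EE, mul_add, Finset.sum_add_distrib]
  | succ N ih =>
    intro f g
    simp only [EE]
    rw [← ih]
    congr 1; funext x
    simp only [mul_add, Finset.sum_add_distrib]

lemma EE_sum {α : Type*} (s : Finset α) (N : ℕ) (f : α → (ℕ → Fin n) → ℝ) :
    EE P pi0 N (fun x => ∑ a ∈ s, f a x) = ∑ a ∈ s, EE P pi0 N (f a) := by
  classical
  induction s using Finset.induction_on with
  | empty =>
    have := EE_smul (P := P) (pi0 := pi0) 0 N (fun _ => 0)
    simpa using this
  | insert a s ha ih =>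
    simp only [Finset.sum_insert ha]
    rw [EE_add, ih]

lemma EE_dep_succ (hP : MJ.RowStochastic P) (N : ℕ) (f : (ℕ → Fin n) → ℝ) (hf : Dep N f) :
    EE P pi0 (N+1) f = EE P pi0 N f := by
  simp only [EE]
  congr 1; funext x
  have : ∀ j, f (upd x (N+1) j) = f x := fun j => hf _ _ fun t ht => by
    simp [upd, Nat.lt_succ_of_le ht]
  simp only [this, ← Finset.sum_mul, hP.2, one_mul]

lemma Dep.mono {m m' : ℕ} (h : m ≤ m') {f : (ℕ → Fin n) → ℝ} (hf : Dep m f) : Dep m' f :=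
  fun x y hxy => hf x y fun t ht => hxy t (ht.trans h)

lemma EE_dep (hP : MJ.RowStochastic P) (M N : ℕ) (hMN : M ≤ N) (f : (ℕ → Fin n) → ℝ)
    (hf : Dep M f) : EE P pi0 N f = EE P pi0 M f := by
  induction N, hMN using Nat.le_induction with
  | base => rfl
  | succ N h ih => rw [EE_dep_succ hP N f (hf.mono h), ih]

lemma EE_const (hP : MJ.RowStochastic P) (h0 : MJ.IsProbVec pi0) (N : ℕ) (c : ℝ) :
    EE P pi0 N (fun _ => c) = c := by
  rw [EE_dep hP 0 N (Nat.zero_le _) _ (fun _ _ _ => rfl)]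
  simp only [EE, ← Finset.sum_mul, h0.2, one_mul]

lemma EE_multi (N k : ℕ) : ∀ h : (ℕ → Fin n) → Fin n → ℝ, (∀ j, Dep N (fun x => h x j)) →
    EE P pi0 (N+k) (fun x => h x (x (N+k))) =
      EE P pi0 N (fun x => ∑ j, (P^k) (x N) j * h x j) := by
  induction k with
  | zero =>
    intro h _
    simp [Matrix.one_apply]
  | succ k ih =>
    intro h hh
    have e1 : EE P pi0 (N+(k+1)) (fun x => h x (x (N+(k+1)))) =
        EE P pi0 (N+k) (fun x => ∑ j, P (x (N+k)) j * h x j) := by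
      rw [← add_assoc]
      simp only [EE]
      congr 1; funext x
      refine Finset.sum_congr rfl fun j _ => ?_
      have : upd x (N+k+1) j (N+k+1) = j := by simp [upd]
      rw [this]
      congr 1
      exact hh j _ _ fun t ht => by simp [upd]; intro h; omega
    rw [e1, ih (fun x i => ∑ j, P i j * h x j)]
    · congr 1; funext x
      simp only [pow_succ, Matrix.mul_apply, Finset.sum_mul, Finset.mul_sum]
      rw [Finset.sum_comm]
      exact Finset.sum_congr rfl fun j _ => Finset.sum_congr rfl fun i _ => by ring
    · intro i x y hxy
      exact Finset.sum_congr rfl fun j _ => congrArg (P i j * ·) (hh j x y hxy)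

/-- restriction of a path. -/
def res (N : ℕ) (x : ℕ → Fin n) : Fin (N+1) → Fin n := fun t => x t

lemma EE_path (N : ℕ) : ∀ g : (Fin (N+1) → Fin n) → ℝ,
    ∑ x, MJ.pathWeight N P pi0 x * g x = EE P pi0 N (fun x => g (res N x)) := by
  induction N with
  | zero =>
    intro g
    simp only [EE, MJ.pathWeight]
    rw [← (Equiv.funUnique (Fin 1) (Fin n)).symm.sum_comp]
    refine Finset.sum_congr rfl fun i _ => ?_
    simp
    left; rfl
  | succ N ih =>
    intro g
    simp only [EE]
    rw [← (Fin.snocEquiv (fun _ : Fin (N+2) => Fin n)).sum_comp, Fintype.sum_prod_type,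
      Finset.sum_comm]
    have := ih (fun y => ∑ j, P (y (Fin.last N)) j * g (Fin.snoc (α := fun _ => Fin n) y j))
    convert this using 1
    · refine Finset.sum_congr rfl fun y _ => ?_
      rw [Finset.mul_sum]
      refine Finset.sum_congr rfl fun j _ => ?_
      simp only [Fin.snocEquiv, Equiv.coe_fn_mk, MJ.pathWeight]
      rw [Fin.prod_univ_castSucc]
      have e0 : (Fin.snoc (α := fun _ => Fin n) y j : Fin (N+2) → Fin n) 0 = y 0 := by
        exact Fin.snoc_castSucc (α := fun _ : Fin (N+2) => Fin n) j y 0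
      have e1 : ∀ t : Fin N, (Fin.snoc (α := fun _ => Fin n) y j : Fin (N+2) → Fin n)
          t.castSucc.succ = y t.succ := by
        intro t
        exact Fin.snoc_castSucc (α := fun _ : Fin (N+2) => Fin n) j y t.succ
      rw [e0]
      simp only [Fin.snoc_castSucc, e1, Fin.succ_last, Fin.snoc_last]
      ring
    · congr 1

lemma EE_prob (N : ℕ) (S : Set (Fin (N+1) → Fin n)) :
    MJ.pathProb N P pi0 S = EE P pi0 N (fun x => S.indicator (fun _ => (1:ℝ)) (res N x)) := by
  rw [← EE_path, MJ.pathProb]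
  refine Finset.sum_congr rfl fun x _ => ?_
  by_cases h : x ∈ S <;> simp [h]

/-- additive functional along an arithmetic progression of times. -/
def WW {V : Type*} [AddCommMonoid V] (y : Fin n → Fin n → V) (r K : ℕ) (s : ℕ)
    (x : ℕ → Fin n) : V :=
  ∑ a ∈ Finset.range s, y (x (r + a*K)) (x (r + a*K + 1))

lemma WW_congr {V : Type*} [AddCommMonoid V] (y : Fin n → Fin n → V) (r q : ℕ) (s : ℕ)
    (x x' : ℕ → Fin n) (h : ∀ t, t ≤ r + s * (q+1) + 1 → x t = x' t) :
    WW y r (q+1) (s+1) x = WW y r (q+1) (s+1) x' := by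
  refine Finset.sum_congr rfl fun a ha => ?_
  have ha' : a ≤ s := Nat.lt_succ_iff.1 (Finset.mem_range.1 ha)
  have : a * (q+1) ≤ s * (q+1) := Nat.mul_le_mul_right _ ha'
  rw [h _ (by omega), h _ (by omega)]

lemma EE_step (N q : ℕ) (h : (ℕ → Fin n) → Fin n → Fin n → ℝ)
    (hh : ∀ i j, Dep N (fun x => h x i j)) :
    EE P pi0 (N+q+1) (fun x => h x (x (N+q)) (x (N+q+1))) =
      EE P pi0 N (fun x => ∑ i, (P^q) (x N) i * ∑ j, P i j * h x i j) := by
  rw [← EE_multi N q (fun x i => ∑ j, P i j * h x i j)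
    (fun i x y hxy => Finset.sum_congr rfl fun j _ => congrArg (P i j * ·) (hh i j x y hxy))]
  simp only [EE]
  congr 1; funext x
  refine Finset.sum_congr rfl fun j _ => ?_
  have e1 : upd x (N+q+1) j (N+q+1) = j := by simp [upd]
  have e2 : upd x (N+q+1) j (N+q) = x (N+q) := by simp [upd]
  rw [e1, e2]
  congr 1
  exact hh _ j _ _ fun t ht => by simp [upd]; intro h; omega

lemma chain {V : Type*} [AddCommMonoid V] (hP : MJ.RowStochastic P) (h0 : MJ.IsProbVec pi0)
    (y : Fin n → Fin n → V) (F : V → ℝ) (r q : ℕ) (C ρ : ℝ) (hρ : 0 ≤ ρ)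
    (hF0 : F 0 ≤ C)
    (hb0 : ∀ a, ∑ i, (P^r) a i * ∑ j, P i j * F (y i j) ≤ C * ρ)
    (hb1 : ∀ s x a, ∑ i, (P^q) a i * ∑ j, P i j * F (WW y r (q+1) s x + y i j)
      ≤ ρ * F (WW y r (q+1) s x)) (m N : ℕ) (hm : m = 0 ∨ r + (m-1)*(q+1) + 1 ≤ N) :
    EE P pi0 N (fun x => F (WW y r (q+1) m x)) ≤ C * ρ^m := by
  have key : ∀ s, EE P pi0 (r + s*(q+1) + 1) (fun x => F (WW y r (q+1) (s+1) x)) ≤ C * ρ^(s+1) := by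
    intro s
    induction s with
    | zero =>
      have e := EE_step (P := P) (pi0 := pi0) 0 r (fun _ i j => F (y i j)) (fun i j x y _ => rfl)
      simp only [zero_add] at e
      simp only [WW, zero_add, Finset.sum_range_one, zero_mul, add_zero]
      rw [e, pow_one]
      calc _ ≤ EE P pi0 0 (fun _ => C * ρ) := EE_mono hP h0 0 _ _ fun x => hb0 _
        _ = _ := EE_const hP h0 0 _
    | succ s ih =>
      have e := EE_step (P := P) (pi0 := pi0) (r + s*(q+1)+1) q
        (fun x i j => F (WW y r (q+1) (s+1) x + y i j))
        (fun i j x x' hx => by simp only; rw [WW_congr y r q s x x' hx])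
      have e3 : r + s*(q+1)+1 + q = r + (s+1)*(q+1) := by ring
      rw [e3] at e
      have e2 : (fun x : ℕ → Fin n => F (WW y r (q+1) (s+1+1) x)) =
          fun x => F (WW y r (q+1) (s+1) x +
            y (x (r + (s+1)*(q+1))) (x (r + (s+1)*(q+1) + 1))) := by
        funext x
        rw [WW, Finset.sum_range_succ]; rfl
      rw [e2, e]
      calc _ ≤ EE P pi0 (r + s*(q+1)+1) (fun x => ρ * F (WW y r (q+1) (s+1) x)) :=
            EE_mono hP h0 _ _ _ fun x => hb1 _ _ _
        _ = ρ * EE P pi0 (r + s*(q+1)+1) (fun x => F (WW y r (q+1) (s+1) x)) := EE_smul _ _ _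
        _ ≤ ρ * (C * ρ^(s+1)) := mul_le_mul_of_nonneg_left ih hρ
        _ = _ := by ring
  rcases Nat.eq_zero_or_pos m with rfl | hpos
  · simp only [WW, Finset.range_zero, Finset.sum_empty, pow_zero, mul_one]
    rw [EE_const hP h0]; exact hF0
  · obtain ⟨s, rfl⟩ : ∃ s, m = s+1 := ⟨m-1, by omega⟩
    rcases hm with hm | hm
    · omega
    · simp only [Nat.add_sub_cancel] at hm
      rw [EE_dep hP _ N hm]
      · exact key s
      · intro x x' hx
        simp only; rw [WW_congr y r q s x x' hx]

/-- number of times below `N` congruent to `r`. -/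
def mr (N q r : ℕ) : ℕ := (N + q - r) / (q+1)

lemma lt_mr (N q r s : ℕ) (hr : r ≤ q) : s < mr N q r ↔ r + s*(q+1) < N := by
  rw [mr, Nat.lt_iff_add_one_le, Nat.le_div_iff_mul_le (Nat.succ_pos q), add_mul]
  generalize s*(q+1) = z
  omega

lemma mr_cond (N q r : ℕ) (hr : r ≤ q) : mr N q r = 0 ∨ r + (mr N q r - 1)*(q+1) + 1 ≤ N := by
  rcases Nat.eq_zero_or_pos (mr N q r) with h | h
  · left; exact h
  · right
    have := (lt_mr N q r (mr N q r - 1) hr).1 (by omega)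
    omega

lemma mr_lower (N q r : ℕ) (hr : r ≤ q) : (N:ℝ) / (q+1) - 1 ≤ mr N q r := by
  have h : ¬ (mr N q r < mr N q r) := lt_irrefl _
  rw [lt_mr N q r _ hr] at h
  have h2 : N ≤ r + mr N q r * (q+1) := by omega
  have h3 : (N:ℝ) ≤ r + mr N q r * (q+1) := by exact_mod_cast h2
  have h4 : (r:ℝ) ≤ q := by exact_mod_cast hr
  have h5 : (0:ℝ) < (q:ℝ)+1 := by positivity
  rw [sub_le_iff_le_add, div_le_iff₀ h5]
  nlinarith

lemma sum_classes {V : Type*} [AddCommMonoid V] (N q : ℕ) (f : ℕ → V) :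
    ∑ t ∈ Finset.range N, f t =
      ∑ r ∈ Finset.range (q+1), ∑ s ∈ Finset.range (mr N q r), f (r + s*(q+1)) := by
  rw [Finset.sum_sigma']
  symm
  refine Finset.sum_bij' (fun z _ => z.1 + z.2*(q+1)) (fun t _ => ⟨t % (q+1), t / (q+1)⟩) ?_ ?_ ?_ ?_ ?_
  · rintro ⟨r, s⟩ h
    simp only [Finset.mem_sigma, Finset.mem_range] at h ⊢
    exact (lt_mr N q r s (by omega)).1 h.2
  · intro t ht
    simp only [Finset.mem_sigma, Finset.mem_range] at ht ⊢
    have h1 : t % (q+1) < q+1 := Nat.mod_lt _ (Nat.succ_pos q)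
    refine ⟨h1, (lt_mr N q _ _ (by omega)).2 ?_⟩
    rw [Nat.mod_add_div' t (q+1)]; exact ht
  · rintro ⟨r, s⟩ h
    simp only [Finset.mem_sigma, Finset.mem_range] at h
    have e1 : (r + s*(q+1)) % (q+1) = r := by
      rw [Nat.add_mul_mod_self_right, Nat.mod_eq_of_lt h.1]
    have e2 : (r + s*(q+1)) / (q+1) = s := by
      rw [Nat.add_mul_div_right _ _ (Nat.succ_pos q), Nat.div_eq_of_lt h.1, zero_add]
    simp only [e1, e2]
  · intro t ht
    exact Nat.mod_add_div' t (q+1)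
  · intro z _; rfl

end Path

end MJH
namespace MJH

section Mix

variable {n : ℕ} {P : Matrix (Fin n) (Fin n) ℝ} {piv : Fin n → ℝ}

lemma rs_pow (hP : MJ.RowStochastic P) (k : ℕ) : MJ.RowStochastic (P^k) := by
  induction k with
  | zero =>
    constructor
    · intro i j; simp only [pow_zero, Matrix.one_apply]; split_ifs <;> norm_num
    · intro i; simp [Matrix.one_apply]
  | succ k ih =>
    rw [pow_succ]
    constructor
    · intro i j
      rw [Matrix.mul_apply]
      exact Finset.sum_nonneg fun l _ => mul_nonneg (ih.1 _ _) (hP.1 _ _)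
    · intro i
      simp only [Matrix.mul_apply]
      rw [Finset.sum_comm]
      simp only [← Finset.mul_sum, hP.2, mul_one, ih.2]

lemma st_pow (hpi : MJ.IsStationary P piv) (k : ℕ) (j : Fin n) :
    ∑ i, piv i * (P^k) i j = piv j := by
  induction k generalizing j with
  | zero => simp [Matrix.one_apply]
  | succ k ih =>
    simp only [pow_succ, Matrix.mul_apply, Finset.mul_sum]
    rw [Finset.sum_comm]
    simp only [← mul_assoc, ← Finset.sum_mul, ih, hpi.2]

lemma contraction (hpi : MJ.IsProbVec piv) (Q : Matrix (Fin n) (Fin n) ℝ)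
    (hQ : ∀ j, ∑ i, piv i * Q i j = piv j) (b : Fin n → ℝ) (c : ℝ)
    (hc : ∀ i, ∑ j, |Q i j - b j| ≤ c) (μ : Fin n → ℝ) (hμ : ∑ i, μ i = 1) :
    ∑ j, |∑ i, μ i * Q i j - piv j| ≤ c * ∑ j, |μ j - piv j| := by
  have e : ∀ j, ∑ i, μ i * Q i j - piv j = ∑ i, (μ i - piv i) * (Q i j - b j) := by
    intro j
    have : ∑ i, (μ i - piv i) * b j = 0 := by
      rw [← Finset.sum_mul, Finset.sum_sub_distrib, hμ, hpi.2]; simp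
    calc _ = ∑ i, μ i * Q i j - ∑ i, piv i * Q i j - ∑ i, (μ i - piv i) * b j := by
          rw [hQ, this, sub_zero]
      _ = _ := by
          rw [← Finset.sum_sub_distrib, ← Finset.sum_sub_distrib]
          exact Finset.sum_congr rfl fun i _ => by ring
  calc _ ≤ ∑ j, ∑ i, |μ i - piv i| * |Q i j - b j| := by
        refine Finset.sum_le_sum fun j _ => ?_
        rw [e]
        refine (Finset.abs_sum_le_sum_abs _ _).trans (le_of_eq ?_)
        exact Finset.sum_congr rfl fun i _ => abs_mul _ _
    _ = ∑ i, |μ i - piv i| * ∑ j, |Q i j - b j| := by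
        rw [Finset.sum_comm]; simp only [Finset.mul_sum]
    _ ≤ ∑ i, |μ i - piv i| * c :=
        Finset.sum_le_sum fun i _ => mul_le_mul_of_nonneg_left (hc i) (abs_nonneg _)
    _ = _ := by rw [← Finset.sum_mul, mul_comm]

lemma dist_le_two {μ : Fin n → ℝ} (h1 : MJ.IsProbVec μ) (h2 : MJ.IsProbVec piv) :
    ∑ j, |μ j - piv j| ≤ 2 := by
  calc _ ≤ ∑ j, (μ j + piv j) := Finset.sum_le_sum fun j _ => by
        rw [abs_le]; constructor <;> linarith [h1.1 j, h2.1 j]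
    _ = 2 := by rw [Finset.sum_add_distrib, h1.2, h2.2]; norm_num

lemma contraction_pow (hP : MJ.RowStochastic P) (hpi : MJ.IsStationary P piv) (t : ℕ)
    (b : Fin n → ℝ) (c : ℝ) (hc0 : 0 ≤ c) (hc : ∀ i, ∑ j, |(P^t) i j - b j| ≤ c) (k : ℕ) (i : Fin n) :
    ∑ j, |(P^(t*k)) i j - piv j| ≤ 2 * c^k := by
  induction k with
  | zero =>
    simp only [mul_zero, pow_zero (M := ℝ), mul_one]
    exact dist_le_two ⟨(rs_pow hP 0).1 i, (rs_pow hP 0).2 i⟩ hpi.1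
  | succ k ih =>
    have := contraction hpi.1 (P^t) (st_pow hpi t) b c hc ((P^(t*k)) i) ((rs_pow hP _).2 i)
    have e : ∀ j, (P^(t*(k+1))) i j = ∑ l, (P^(t*k)) i l * (P^t) l j := fun j => by
      rw [mul_add, mul_one, pow_add, Matrix.mul_apply]
    simp only [e]
    refine this.trans ((mul_le_mul_of_nonneg_left ih hc0).trans (le_of_eq ?_))
    ring

lemma mix_mem (hn : 0 < n) (hP : MJ.RowStochastic P) (hPe : MJ.Ergodic' P)
    (hpi : MJ.IsStationary P piv) (i : Fin n) :
    (1/2) * ∑ j, |(P ^ (MJ.mixingTime P piv (1/4))) i j - piv j| ≤ 1/4 := by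
  have hne : {t : ℕ | ∀ i, (1/2) * ∑ j, |(P ^ t) i j - piv j| ≤ 1/4}.Nonempty := by
    obtain ⟨t, ht⟩ := hPe
    have : Nonempty (Fin n) := ⟨i⟩
    obtain ⟨⟨a, b⟩, -, hab⟩ := Finset.exists_min_image (Finset.univ : Finset (Fin n × Fin n))
      (fun z => (P^t) z.1 z.2) Finset.univ_nonempty
    set α := (P^t) a b with hα
    have hα0 : 0 < α := ht a b
    have hmin : ∀ i j, α ≤ (P^t) i j := fun i j => hab (i,j) (Finset.mem_univ _)
    have hs : ∀ i, ∑ j, |(P^t) i j - α| = 1 - n * α := by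
      intro i
      rw [Finset.sum_congr rfl fun j _ => abs_of_nonneg (sub_nonneg.2 (hmin i j)),
        Finset.sum_sub_distrib, (rs_pow hP t).2]
      simp
    have hc0 : 0 ≤ 1 - n * α := by rw [← hs i]; exact Finset.sum_nonneg fun _ _ => abs_nonneg _
    have hn' : (0:ℝ) < n := by exact_mod_cast hn
    have hc1 : 1 - n * α < 1 := by nlinarith [mul_pos hn' hα0]
    obtain ⟨k, hk⟩ := exists_pow_lt_of_lt_one (show (0:ℝ) < 1/4 by norm_num) hc1
    refine ⟨t*k, fun i => ?_⟩
    have := contraction_pow hP hpi t (fun _ => α) _ hc0 (fun i => (hs i).le) k i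
    linarith
  exact Nat.sInf_mem hne i

lemma mix_pow (hn : 0 < n) (hP : MJ.RowStochastic P) (hPe : MJ.Ergodic' P)
    (hpi : MJ.IsStationary P piv) (k : ℕ) (i : Fin n) :
    ∑ j, |(P ^ (MJ.mixingTime P piv (1/4) * k)) i j - piv j| ≤ 2 * (1/2)^k := by
  refine contraction_pow hP hpi _ piv (1/2) (by norm_num) (fun i => ?_) k i
  have := mix_mem hn hP hPe hpi i
  linarith

end Mix

section Tails

variable {n : ℕ} {P : Matrix (Fin n) (Fin n) ℝ} {piv pi0 : Fin n → ℝ}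

lemma le_one_of_rs (hP : MJ.RowStochastic P) (i j : Fin n) : P i j ≤ 1 := by
  rw [← hP.2 i]
  exact Finset.single_le_sum (fun l _ => hP.1 i l) (Finset.mem_univ j)

lemma WW_Ym_symm (r K s : ℕ) (x : ℕ → Fin n) : (WW (Ym P) r K s x)ᵀ = WW (Ym P) r K s x := by
  rw [WW, Matrix.transpose_sum]
  exact Finset.sum_congr rfl fun a _ => Ym_symm _ _ _

lemma abs_le_of_dist {μ : Fin n → ℝ} {δ : ℝ} (h : ∑ j, |μ j - piv j| ≤ δ) (i : Fin n) :
    |μ i - piv i| ≤ δ :=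
  (Finset.single_le_sum (f := fun j => |μ j - piv j|) (fun _ _ => abs_nonneg _)
    (Finset.mem_univ i)).trans h

lemma matrix_tail (hn : 0 < n) (hP : MJ.RowStochastic P) (h0 : MJ.IsProbVec pi0)
    (hpi : MJ.IsStationary P piv) (q r m N : ℕ) (δ pimax θ : ℝ)
    (hmax : ∀ i, piv i ≤ pimax) (hv0 : 0 ≤ pimax + δ)
    (hδ : ∀ a, ∑ j, |(P^q) a j - piv j| ≤ δ) (hθ : 4 * θ^2 ≤ 1)
    (hm : m = 0 ∨ r + (m-1)*(q+1) + 1 ≤ N) :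
    EE P pi0 N (fun x => (NormedSpace.exp (θ • WW (Ym P) r (q+1) m x)).trace) ≤
      (2 * n * (1 + θ^2)) * (1 + θ^2 * (pimax + δ))^m := by
  have hρ : 1 ≤ 1 + θ^2 * (pimax + δ) := by nlinarith [mul_nonneg (sq_nonneg θ) hv0]
  have htr : (NormedSpace.exp (0 : Matrix (Fin n ⊕ Fin n) (Fin n ⊕ Fin n) ℝ)).trace = 2 * n := by
    rw [NormedSpace.exp_zero, Matrix.trace_one]; simp; ring
  have hn' : (0:ℝ) < n := by exact_mod_cast hn
  refine chain hP h0 (Ym P) (fun A => (NormedSpace.exp (θ • A)).trace) r q _ _ (by linarith)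
    ?_ ?_ ?_ m N hm
  · simp only [smul_zero]
    rw [htr]; nlinarith [mul_nonneg hn'.le (sq_nonneg θ)]
  · intro a
    have hrs := rs_pow hP r
    have := step P hn hP 0 (by simp) ((P^r) a) (hrs.1 a) (hrs.2 a) 1 (le_one_of_rs hrs a)
      (fun j => by
        have h2 := le_one_of_rs (rs_pow hP (r+1)) a j
        rwa [pow_succ, Matrix.mul_apply] at h2) θ hθ
    simp only [zero_add, mul_one] at this
    rw [htr] at this
    have h3 : 0 ≤ 2 * n * (1 + θ^2) := by positivity
    calc _ ≤ _ := this
      _ = (2 * n * (1 + θ^2)) * 1 := by ring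
      _ ≤ _ := mul_le_mul_of_nonneg_left hρ h3
  · intro s x a
    have hrs := rs_pow hP q
    simp only [smul_add]
    refine step P hn hP (θ • WW (Ym P) r (q+1) s x) ?_ ((P^q) a) (hrs.1 a) (hrs.2 a) (pimax + δ)
      ?_ ?_ θ hθ
    · rw [Matrix.transpose_smul, WW_Ym_symm]
    · intro i
      have := abs_le_of_dist (hδ a) i
      linarith [(abs_le.1 this).2, hmax i]
    · intro j
      have h1 : ∑ i, (P^q) a i * P i j - piv j ≤ δ := by
        rw [← hpi.2 j, ← Finset.sum_sub_distrib]
        refine (Finset.sum_le_sum fun i _ => ?_).trans (hδ a)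
        rw [← sub_mul]
        calc _ ≤ |(P^q) a i - piv i| * P i j := mul_le_mul_of_nonneg_right (le_abs_self _) (hP.1 _ _)
          _ ≤ |(P^q) a i - piv i| * 1 :=
            mul_le_mul_of_nonneg_left (le_one_of_rs hP i j) (abs_nonneg _)
          _ = _ := mul_one _
      linarith [hmax j]

lemma exp_neg_le (θ : ℝ) (h : 0 ≤ θ) : Real.exp (-θ) ≤ 1 - (θ - θ^2/2) := by
  have h1 := Real.quadratic_le_exp_of_nonneg h
  have h2 : Real.exp (-θ) * Real.exp θ = 1 := by rw [← Real.exp_add]; simp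
  have h3 : 0 < Real.exp (-θ) := Real.exp_pos _
  have h4 : 0 < 1 + θ + θ^2/2 := by positivity
  have h5 : Real.exp (-θ) * (1 + θ + θ^2/2) ≤ 1 := by nlinarith
  have h6 : 1 ≤ (1 - (θ - θ^2/2)) * (1 + θ + θ^2/2) := by nlinarith [sq_nonneg (θ^2)]
  exact le_of_mul_le_mul_right (h5.trans h6) h4

/-- visit indicator. -/
def Yc (i : Fin n) : Fin n → Fin n → ℝ := fun a _ => if a = i then 1 else 0

lemma count_step (hP : MJ.RowStochastic P) (μ : Fin n → ℝ) (hμ : MJ.IsProbVec μ) (i : Fin n)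
    (p θ w : ℝ) (hp : p ≤ μ i) (hθ0 : 0 ≤ θ) (hθ1 : θ ≤ 1) :
    ∑ a, μ a * ∑ j, P a j * Real.exp (-θ * (w + Yc i a j)) ≤
      Real.exp (-(p * (θ - θ^2/2))) * Real.exp (-θ * w) := by
  have e : ∀ a, ∑ j, P a j * Real.exp (-θ * (w + Yc i a j)) =
      Real.exp (-θ * w) * (1 - (if a = i then 1 - Real.exp (-θ) else 0)) := by
    intro a
    by_cases h : a = i
    · simp only [Yc, h, if_true]
      rw [← Finset.sum_mul, hP.2, one_mul, mul_add, Real.exp_add]; simp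
    · simp only [Yc, h, if_false]
      rw [← Finset.sum_mul, hP.2]; simp
  simp only [e]
  have e2 : ∑ a, μ a * (Real.exp (-θ * w) * (1 - (if a = i then 1 - Real.exp (-θ) else 0))) =
      Real.exp (-θ * w) * (1 - μ i * (1 - Real.exp (-θ))) := by
    have : ∑ a, μ a * (1 - (if a = i then 1 - Real.exp (-θ) else 0)) =
        1 - μ i * (1 - Real.exp (-θ)) := by
      simp only [mul_sub, Finset.sum_sub_distrib, mul_one, hμ.2]
      simp
      ring
    rw [← this, Finset.mul_sum]
    exact Finset.sum_congr rfl fun a _ => by ring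
  rw [e2, mul_comm]
  refine mul_le_mul_of_nonneg_right ?_ (Real.exp_pos _).le
  have h1 := exp_neg_le θ hθ0
  have h2 : 0 ≤ θ - θ^2/2 := by nlinarith
  have h3 := Real.add_one_le_exp (-(p * (θ - θ^2/2)))
  have h4 : p * (θ - θ^2/2) ≤ μ i * (1 - Real.exp (-θ)) := by
    calc _ ≤ μ i * (θ - θ^2/2) := mul_le_mul_of_nonneg_right hp h2
      _ ≤ _ := mul_le_mul_of_nonneg_left (by linarith) (hμ.1 i)
  linarith

lemma count_tail (hP : MJ.RowStochastic P) (h0 : MJ.IsProbVec pi0)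
    (q r m N : ℕ) (δ θ : ℝ) (i : Fin n) (hp0 : 0 ≤ piv i - δ)
    (hδ : ∀ a, ∑ j, |(P^q) a j - piv j| ≤ δ) (hθ0 : 0 ≤ θ) (hθ1 : θ ≤ 1)
    (hm : m = 0 ∨ r + (m-1)*(q+1) + 1 ≤ N) :
    EE P pi0 N (fun x => Real.exp (-θ * WW (Yc i) r (q+1) m x)) ≤
      Real.exp ((piv i - δ) * (θ - θ^2/2)) * Real.exp (-((piv i - δ) * (θ - θ^2/2)))^m := by
  have h2 : 0 ≤ θ - θ^2/2 := by nlinarith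
  refine chain hP h0 (Yc i) (fun w => Real.exp (-θ * w)) r q _ _ (Real.exp_pos _).le ?_ ?_ ?_ m N hm
  · simp only [mul_zero, Real.exp_zero]
    exact Real.one_le_exp (mul_nonneg hp0 h2)
  · intro a
    have hrs := rs_pow hP r
    have := count_step hP ((P^r) a) ⟨hrs.1 a, hrs.2 a⟩ i 0 θ 0 (hrs.1 a i) hθ0 hθ1
    simp only [zero_add, zero_mul, mul_zero, neg_zero, Real.exp_zero, mul_one] at this
    rw [← Real.exp_add, add_neg_cancel, Real.exp_zero]
    exact this
  · intro s x a
    have hrs := rs_pow hP q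
    refine count_step hP ((P^q) a) ⟨hrs.1 a, hrs.2 a⟩ i _ θ _ ?_ hθ0 hθ1
    have := abs_le_of_dist (hδ a) i
    linarith [(abs_le.1 this).1]

end Tails

end MJH
namespace MJH

section Good

variable {n : ℕ} {P : Matrix (Fin n) (Fin n) ℝ} {piv pi0 : Fin n → ℝ}

lemma shift_exp (N q r : ℕ) (hr : r ≤ q) (X : ℝ) (hX : 0 ≤ X) :
    Real.exp (-(mr N q r * X)) ≤ Real.exp X * Real.exp (-((N:ℝ) / (q+1) * X)) := by
  rw [← Real.exp_add]
  refine Real.exp_le_exp.2 ?_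
  have := mul_le_mul_of_nonneg_right (mr_lower N q r hr) hX
  linarith

lemma class_matrix (hn : 0 < n) (hP : MJ.RowStochastic P) (h0 : MJ.IsProbVec pi0)
    (hpi : MJ.IsStationary P piv) (q r N : ℕ) (hr : r ≤ q) (e pimax θ : ℝ)
    (hmax : ∀ i, piv i ≤ pimax) (he : 0 < e) (hem : e ≤ pimax / 2)
    (hδ : ∀ a, ∑ j, |(P^q) a j - piv j| ≤ e/4)
    (hθ : θ = (3/4*e) / (2 * (pimax + e/4))) :
    EE P pi0 N (fun x => Real.exp (-(θ * (3/4*e) * mr N q r)) *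
      (NormedSpace.exp (θ • WW (Ym P) r (q+1) (mr N q r) x)).trace) ≤
      2.08 * n * Real.exp (-(mr N q r * (e^2/(8*pimax)))) := by
  have hm0 : 0 < pimax := by linarith
  have hv : 0 < pimax + e/4 := by linarith
  have hθ0 : 0 < θ := by rw [hθ]; positivity
  have hθ2 : θ ≤ 0.1875 := by
    rw [hθ, div_le_iff₀ (by positivity)]; linarith
  have hθ3 : 4 * θ^2 ≤ 1 := by nlinarith
  have hn' : (0:ℝ) < n := by exact_mod_cast hn
  rw [EE_smul]
  have h1 := matrix_tail hn hP h0 hpi q r (mr N q r) N (e/4) pimax θ hmax hv.le hδ hθ3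
    (mr_cond N q r hr)
  set m := mr N q r
  have hθv : θ * (2 * (pimax + e/4)) = 3/4*e := by rw [hθ]; field_simp
  have hX : θ^2 * (pimax + e/4) - θ * (3/4*e) ≤ -(e^2/(8*pimax)) := by
    have a1 : θ^2 * (pimax + e/4) - θ * (3/4*e) = - (θ * (3/8*e)) := by
      have : θ^2 * (pimax + e/4) = θ * (3/8*e) := by
        rw [show θ * (3/8*e) = θ * ((3/4*e)/2) by ring, ← hθv]; ring
      rw [this]; ring
    rw [a1]
    refine neg_le_neg ?_
    rw [div_le_iff₀ (by positivity)]
    have a2 : e/3 ≤ θ * pimax := by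
      have h4 : θ * (2 * (pimax + e/4)) ≤ θ * (9/4*pimax) :=
        mul_le_mul_of_nonneg_left (by linarith) hθ0.le
      rw [hθv] at h4
      linarith
    nlinarith
  have h2 : (1 + θ^2 * (pimax + e/4))^m ≤ Real.exp (θ^2 * (pimax + e/4) * m) := by
    rw [mul_comm (θ^2 * (pimax + e/4)) (m:ℝ), Real.exp_nat_mul]
    refine pow_le_pow_left₀ (by positivity) ?_ _
    linarith [Real.add_one_le_exp (θ^2 * (pimax + e/4))]
  calc _ ≤ Real.exp (-(θ * (3/4*e) * m)) * ((2 * n * (1 + θ^2)) * Real.exp (θ^2 * (pimax + e/4) * m)) := by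
        refine mul_le_mul_of_nonneg_left (h1.trans ?_) (Real.exp_pos _).le
        exact mul_le_mul_of_nonneg_left h2 (by positivity)
    _ = (2 * n * (1 + θ^2)) * Real.exp (m * (θ^2 * (pimax + e/4) - θ * (3/4*e))) := by
        rw [mul_comm, mul_assoc, ← Real.exp_add]; congr 2; ring
    _ ≤ (2.08 * n) * Real.exp (-(m * (e^2/(8*pimax)))) := by
        refine mul_le_mul ?_ (Real.exp_le_exp.2 ?_) (Real.exp_pos _).le (by positivity)
        · have : θ^2 ≤ 0.04 := by nlinarith
          have := mul_le_mul_of_nonneg_left this hn'.le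
          linarith
        · rw [← mul_neg]
          exact mul_le_mul_of_nonneg_left hX (Nat.cast_nonneg _)

lemma class_count (hP : MJ.RowStochastic P) (h0 : MJ.IsProbVec pi0)
    (q r N : ℕ) (hr : r ≤ q) (e pimax θ : ℝ) (i : Fin n)
    (hmax : piv i ≤ pimax) (he : 0 < e) (he4 : e ≤ 1/4) (hem : e ≤ piv i / 2)
    (hδ : ∀ a, ∑ j, |(P^q) a j - piv j| ≤ e/4)
    (hθ : θ = e / (2 * piv i)) :
    EE P pi0 N (fun x => Real.exp (θ * (piv i - 3/4*e) * mr N q r) *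
      Real.exp (-θ * WW (Yc i) r (q+1) (mr N q r) x)) ≤
      1.15 * Real.exp (-(mr N q r * (e^2/(8*pimax)))) := by
  have hp : 0 < piv i := by linarith
  have hm0 : 0 < pimax := by linarith
  have hθ0 : 0 < θ := by rw [hθ]; positivity
  have hθp : θ * piv i = e/2 := by rw [hθ]; field_simp
  have hθ1 : θ ≤ 1 := by
    rw [hθ, div_le_iff₀ (by positivity)]; linarith
  rw [EE_smul]
  have h1 := count_tail (piv := piv) hP h0 q r (mr N q r) N (e/4) θ i (by linarith) hδ hθ0.le hθ1
    (mr_cond N q r hr)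
  set m := mr N q r
  have ha : (piv i - e/4) * (θ - θ^2/2) ≤ 1/8 := by
    have : (piv i - e/4) * (θ - θ^2/2) ≤ piv i * θ := by
      have : 0 ≤ e/4 * (θ - θ^2/2) := mul_nonneg (by linarith) (by nlinarith)
      nlinarith [mul_nonneg hp.le (sq_nonneg θ)]
    linarith
  have h3 : Real.exp ((piv i - e/4) * (θ - θ^2/2)) ≤ 1.15 := by
    refine (Real.exp_le_exp.2 ha).trans ?_
    have := Real.exp_bound_div_one_sub_of_interval (x := 1/8) (by norm_num) (by norm_num)
    norm_num at this ⊢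
    linarith
  have hX : θ * (piv i - 3/4*e) - (piv i - e/4) * (θ - θ^2/2) ≤ -(e^2/(8*pimax)) := by
    have a1 : θ * (piv i - 3/4*e) - (piv i - e/4) * (θ - θ^2/2) =
        -(θ * e/2) + (piv i - e/4) * θ^2/2 := by ring
    have a2 : (piv i - e/4) * θ^2/2 ≤ θ * e / 4 := by
      have : 0 ≤ e/4 * θ^2 := by positivity
      have : piv i * θ^2 = θ * e/2 := by
        rw [show piv i * θ^2 = θ * (θ * piv i) by ring, hθp]; ring
      nlinarith
    have a3 : e^2/(8*pimax) ≤ θ * e / 4 := by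
      rw [div_le_iff₀ (by positivity)]
      have : e/2 ≤ θ * pimax := by rw [← hθp]; exact mul_le_mul_of_nonneg_left hmax hθ0.le
      nlinarith
    linarith
  calc _ ≤ Real.exp (θ * (piv i - 3/4*e) * m) * (1.15 * Real.exp (-((piv i - e/4) * (θ - θ^2/2)))^m) := by
        refine mul_le_mul_of_nonneg_left (h1.trans ?_) (Real.exp_pos _).le
        exact mul_le_mul_of_nonneg_right h3 (by positivity)
    _ = 1.15 * Real.exp (m * (θ * (piv i - 3/4*e) - (piv i - e/4) * (θ - θ^2/2))) := by
        rw [← Real.exp_nat_mul, mul_comm, mul_assoc, ← Real.exp_add]; congr 2; ring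
    _ ≤ 1.15 * Real.exp (-(m * (e^2/(8*pimax)))) := by
        refine mul_le_mul_of_nonneg_left (Real.exp_le_exp.2 ?_) (by norm_num)
        rw [← mul_neg]
        exact mul_le_mul_of_nonneg_left hX (Nat.cast_nonneg _)

lemma prob_good (hn : 0 < n) (hP : MJ.RowStochastic P) (h0 : MJ.IsProbVec pi0)
    (hpi : MJ.IsStationary P piv) (q N : ℕ) (e pimax θ : ℝ)
    (hmax : ∀ i, piv i ≤ pimax) (he : 0 < e) (he4 : e ≤ 1/4) (hem : ∀ i, e ≤ piv i / 2)
    (hδ : ∀ a, ∑ j, |(P^q) a j - piv j| ≤ e/4)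
    (hθ : θ = (3/4*e) / (2 * (pimax + e/4)))
    (S : Set (Fin (N+1) → Fin n))
    (hS : ∀ x : ℕ → Fin n,
      (∀ r, r ≤ q → (NormedSpace.exp (θ • WW (Ym P) r (q+1) (mr N q r) x)).trace
        < Real.exp (θ * (3/4*e) * mr N q r)) →
      (∀ r, r ≤ q → ∀ i, (piv i - 3/4*e) * mr N q r ≤ WW (Yc i) r (q+1) (mr N q r) x) →
      res N x ∈ S) :
    1 - 3.3 * n * (q+1) * Real.exp (-((N:ℝ)/(q+1) * (e^2/(8*pimax)))) ≤ MJ.pathProb N P pi0 S := by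
  set X := e^2/(8*pimax) with hXdef
  have i0 : Fin n := ⟨0, hn⟩
  have hem' : e ≤ pimax/2 := by linarith [hem i0, hmax i0]
  have hm0 : 0 < pimax := by linarith
  have hX0 : 0 ≤ X := by positivity
  have hX1 : X ≤ 1/64 := by
    rw [hXdef, div_le_iff₀ (by positivity)]; nlinarith
  have hθ0 : 0 < θ := by rw [hθ]; positivity
  have heX : Real.exp X ≤ 1.02 := by
    refine (Real.exp_le_exp.2 hX1).trans ?_
    have := Real.exp_bound_div_one_sub_of_interval (x := 1/64) (by norm_num) (by norm_num)
    norm_num at this ⊢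
    linarith
  set A : ℕ → (ℕ → Fin n) → ℝ := fun r x => Real.exp (-(θ * (3/4*e) * mr N q r)) *
      (NormedSpace.exp (θ • WW (Ym P) r (q+1) (mr N q r) x)).trace with hA
  set B : ℕ → Fin n → (ℕ → Fin n) → ℝ := fun r i x =>
      Real.exp ((e / (2 * piv i)) * (piv i - 3/4*e) * mr N q r) *
      Real.exp (-(e / (2 * piv i)) * WW (Yc i) r (q+1) (mr N q r) x) with hB
  have hA0 : ∀ r x, 0 ≤ A r x := fun r x => mul_nonneg (Real.exp_pos _).le
    (exp_trace_nonneg _ (by rw [Matrix.transpose_smul, WW_Ym_symm]))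
  have hB0 : ∀ r i x, 0 ≤ B r i x := fun r i x => by positivity
  have hpt : ∀ x, (1:ℝ) ≤ S.indicator (fun _ => (1:ℝ)) (res N x) +
      ∑ r ∈ Finset.range (q+1), (A r x + ∑ i, B r i x) := by
    intro x
    by_cases hx : res N x ∈ S
    · rw [Set.indicator_of_mem hx]
      have : 0 ≤ ∑ r ∈ Finset.range (q+1), (A r x + ∑ i, B r i x) :=
        Finset.sum_nonneg fun r _ => add_nonneg (hA0 r x) (Finset.sum_nonneg fun i _ => hB0 r i x)
      linarith
    · rw [Set.indicator_of_notMem hx, zero_add]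
      have hsuf : ∃ r, r ≤ q ∧ 1 ≤ A r x + ∑ i, B r i x := by
        by_contra hcon
        push Not at hcon
        refine hx (hS x ?_ ?_)
        · intro r hr
          have h1 : A r x < 1 := lt_of_le_of_lt (le_add_of_nonneg_right
            (Finset.sum_nonneg fun i _ => hB0 r i x)) (hcon r hr)
          have h2 := mul_lt_mul_of_pos_left h1 (Real.exp_pos (θ * (3/4*e) * mr N q r))
          simp only [hA] at h2
          rw [← mul_assoc, ← Real.exp_add, add_neg_cancel, Real.exp_zero, one_mul, mul_one] at h2
          exact h2
        · intro r hr i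
          have h1 : B r i x < 1 := by
            have : B r i x ≤ ∑ i, B r i x :=
              Finset.single_le_sum (f := fun i => B r i x) (fun i _ => hB0 r i x) (Finset.mem_univ i)
            linarith [hcon r hr, hA0 r x]
          simp only [hB] at h1
          rw [← Real.exp_add, Real.exp_lt_one_iff] at h1
          have hp : 0 < piv i := by linarith [hem i]
          have hpos : 0 < e / (2 * piv i) := by positivity
          by_contra hc
          push Not at hc
          have := mul_lt_mul_of_pos_left hc hpos
          linarith
      obtain ⟨r, hr, h1⟩ := hsuf
      refine h1.trans ?_
      exact Finset.single_le_sum (f := fun r => A r x + ∑ i, B r i x)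
        (fun r _ => add_nonneg (hA0 r x) (Finset.sum_nonneg fun i _ => hB0 r i x))
        (Finset.mem_range.2 (Nat.lt_succ_of_le hr))
  have hE := EE_mono hP h0 N _ _ hpt
  rw [EE_const hP h0, EE_add, EE_sum, ← EE_prob] at hE
  set Z := Real.exp (-((N:ℝ)/(q+1) * X)) with hZ
  have hZ0 : 0 < Z := Real.exp_pos _
  have hcls : ∀ r ∈ Finset.range (q+1), EE P pi0 N (fun x => A r x + ∑ i, B r i x) ≤
      3.3 * n * Z := by
    intro r hr
    have hr' : r ≤ q := Nat.lt_succ_iff.1 (Finset.mem_range.1 hr)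
    have hsh := shift_exp N q r hr' X hX0
    have hsh2 : Real.exp (-(mr N q r * X)) ≤ 1.02 * Z :=
      hsh.trans (mul_le_mul_of_nonneg_right heX hZ0.le)
    rw [EE_add, EE_sum]
    have c1 : EE P pi0 N (A r) ≤ 2.08 * n * (1.02 * Z) :=
      (class_matrix hn hP h0 hpi q r N hr' e pimax θ hmax he hem' hδ hθ).trans
        (mul_le_mul_of_nonneg_left hsh2 (by positivity))
    have c2 : ∀ i, EE P pi0 N (B r i) ≤ 1.15 * (1.02 * Z) := fun i =>
      (class_count hP h0 q r N hr' e pimax _ i (hmax i) he he4 (hem i) hδ rfl).trans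
        (mul_le_mul_of_nonneg_left hsh2 (by positivity))
    have c3 : ∑ i, EE P pi0 N (B r i) ≤ n * (1.15 * (1.02 * Z)) := by
      refine (Finset.sum_le_sum fun i _ => c2 i).trans ?_
      simp
    have : 0 ≤ n * Z := by positivity
    nlinarith
  have hsum := Finset.sum_le_sum hcls
  rw [Finset.sum_const, Finset.card_range, nsmul_eq_mul] at hsum
  push_cast at hsum
  nlinarith

end Good

end MJH
namespace MJH

section Det

variable {n : ℕ} {P : Matrix (Fin n) (Fin n) ℝ} {piv : Fin n → ℝ}

lemma Ym_quad (P : Matrix (Fin n) (Fin n) ℝ) (i j : Fin n) (w z : Fin n → ℝ) :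
    Sum.elim w z ⬝ᵥ (Ym P i j *ᵥ Sum.elim w z) = 2 * (w i * (z j - (P *ᵥ z) i)) := by
  have e1 : w ⬝ᵥ (Bm P i j *ᵥ z) = w i * (z j - (P *ᵥ z) i) := by
    simp only [dotProduct, Matrix.mulVec, Bm, Matrix.of_apply]
    rw [Finset.sum_eq_single i (by intro b _ hb; simp [hb]) (by simp)]
    congr 1
    simp only [if_true, one_mul, sub_mul, Finset.sum_sub_distrib]
    simp
  have e2 : z ⬝ᵥ ((Bm P i j)ᵀ *ᵥ w) = w i * (z j - (P *ᵥ z) i) := by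
    rw [← e1, Matrix.mulVec_transpose, dotProduct_comm, Matrix.dotProduct_mulVec]
  rw [Ym, Matrix.fromBlocks_mulVec]
  simp only [Matrix.zero_mulVec, zero_add, add_zero, Sum.elim_comp_inl, Sum.elim_comp_inr]
  rw [sumElim_dotProduct_sumElim, e1, e2]; ring

lemma WW_quad (r K s : ℕ) (x : ℕ → Fin n) (w z : Fin n → ℝ) :
    Sum.elim w z ⬝ᵥ (WW (Ym P) r K s x *ᵥ Sum.elim w z) =
      ∑ a ∈ Finset.range s, 2 * (w (x (r + a*K)) * (z (x (r + a*K + 1)) - (P *ᵥ z) (x (r + a*K)))) := by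
  rw [WW, Matrix.sum_mulVec, dotProduct_sum]
  exact Finset.sum_congr rfl fun a _ => Ym_quad P _ _ w z

lemma noise_quad (q N : ℕ) (x : ℕ → Fin n) (θ t : ℝ) (hθ : 0 < θ)
    (h : ∀ r, r ≤ q → (NormedSpace.exp (θ • WW (Ym P) r (q+1) (mr N q r) x)).trace
        < Real.exp (θ * t * mr N q r)) (w z : Fin n → ℝ) :
    ∑ s ∈ Finset.range N, 2 * (w (x s) * (z (x (s+1)) - (P *ᵥ z) (x s))) ≤
      t * N * (∑ i, w i ^ 2 + ∑ i, z i ^ 2) := by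
  rw [sum_classes N q (fun s => 2 * (w (x s) * (z (x (s+1)) - (P *ᵥ z) (x s))))]
  have hN : (N:ℝ) = ∑ r ∈ Finset.range (q+1), (mr N q r : ℝ) := by
    have := sum_classes N q (fun _ => (1:ℝ))
    simpa using this
  rw [hN, Finset.mul_sum, Finset.sum_mul]
  refine Finset.sum_le_sum fun r hr => ?_
  have hr' : r ≤ q := Nat.lt_succ_iff.1 (Finset.mem_range.1 hr)
  have h1 := trace_exp_quad (θ • WW (Ym P) r (q+1) (mr N q r) x)
    (by rw [Matrix.transpose_smul, WW_Ym_symm]) _ (h r hr') (Sum.elim w z)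
  rw [Matrix.smul_mulVec, dotProduct_smul, WW_quad, smul_eq_mul, Fintype.sum_sum_type] at h1
  simp only [Sum.elim_inl, Sum.elim_inr] at h1
  have h2 : θ * _ ≤ θ * (t * mr N q r * (∑ i, w i ^ 2 + ∑ i, z i ^ 2)) :=
    h1.trans (le_of_eq (by ring))
  exact le_of_mul_le_mul_left h2 hθ

lemma fin_sum (N : ℕ) (x : ℕ → Fin n) (f : Fin n → Fin n → ℝ) :
    ∑ s : Fin N, f (res N x s.castSucc) (res N x s.succ) =
      ∑ s ∈ Finset.range N, f (x s) (x (s+1)) := by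
  rw [Finset.sum_range]; rfl

/-- row noise. -/
def gn {N : ℕ} (P : Matrix (Fin n) (Fin n) ℝ) (x : Fin (N+1) → Fin n) (z : Fin n → ℝ) (i : Fin n) : ℝ :=
  ∑ s : Fin N, if x s.castSucc = i then z (x s.succ) - (P *ᵥ z) i else 0

lemma noise_bound (q N : ℕ) (x : ℕ → Fin n) (θ t : ℝ) (hθ : 0 < θ) (ht : 0 < t) (hN : 0 < N)
    (h : ∀ r, r ≤ q → (NormedSpace.exp (θ • WW (Ym P) r (q+1) (mr N q r) x)).trace
        < Real.exp (θ * t * mr N q r)) (z : Fin n → ℝ) (hz : ∑ i, z i ^ 2 ≤ 1) :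
    ∑ i, gn P (res N x) z i ^ 2 ≤ (t * N)^2 := by
  set g := gn P (res N x) z with hg
  have hT : 0 < t * N := mul_pos ht (by exact_mod_cast hN)
  set T := t * N with hTd
  have h1 := noise_quad q N x θ t hθ h (fun i => g i / T) z
  rw [← fin_sum N x (fun a b => 2 * (g a / T * (z b - (P *ᵥ z) a)))] at h1
  have h2 : ∑ s : Fin N, 2 * (g (res N x s.castSucc) / T *
      (z (res N x s.succ) - (P *ᵥ z) (res N x s.castSucc))) = 2 / T * ∑ i, g i ^ 2 := by
    have : ∀ i, g i ^ 2 = ∑ s : Fin N, if res N x s.castSucc = i then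
        g i * (z (res N x s.succ) - (P *ᵥ z) i) else 0 := by
      intro i
      rw [sq]; nth_rewrite 2 [hg]
      rw [gn, Finset.mul_sum]
      exact Finset.sum_congr rfl fun s _ => by split_ifs <;> simp
    simp only [this]
    rw [Finset.sum_comm, Finset.mul_sum]
    refine Finset.sum_congr rfl fun s _ => ?_
    rw [Finset.sum_ite_eq]
    simp only [Finset.mem_univ, if_true]
    ring
  rw [h2] at h1
  have h3 : ∑ i, (g i / T)^2 = (∑ i, g i ^ 2) / T^2 := by
    rw [Finset.sum_div]; exact Finset.sum_congr rfl fun i _ => by rw [div_pow]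
  rw [h3] at h1
  have h4 : T * ((∑ i, g i ^ 2) / T^2 + ∑ i, z i ^ 2) = (∑ i, g i ^ 2)/T + T * ∑ i, z i ^ 2 := by
    field_simp
  rw [h4] at h1
  have h5 : (∑ i, g i ^ 2) / T ≤ T := by
    have : 2 / T * ∑ i, g i ^ 2 = 2 * ((∑ i, g i ^ 2)/T) := by ring
    nlinarith
  rw [div_le_iff₀ hT] at h5
  linarith

lemma count_lower (q N : ℕ) (x : ℕ → Fin n) (c : ℝ) (i : Fin n)
    (h : ∀ r, r ≤ q → c * mr N q r ≤ WW (Yc i) r (q+1) (mr N q r) x) :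
    c * N ≤ MJ.countState (res N x) i := by
  have e : (MJ.countState (res N x) i : ℝ) = ∑ s ∈ Finset.range N, Yc i (x s) (x (s+1)) := by
    rw [← fin_sum N x (Yc i), MJ.countState, Finset.card_filter]
    push_cast
    exact Finset.sum_congr rfl fun s _ => rfl
  rw [e, sum_classes N q (fun s => Yc i (x s) (x (s+1)))]
  have hN : (N:ℝ) = ∑ r ∈ Finset.range (q+1), (mr N q r : ℝ) := by
    have := sum_classes N q (fun _ => (1:ℝ))
    simpa using this
  rw [hN, Finset.mul_sum]
  exact Finset.sum_le_sum fun r hr => h r (Nat.lt_succ_iff.1 (Finset.mem_range.1 hr))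

lemma key_ineq (C R a l g : ℝ) (hC : 2 * R ≤ C) (ha : 0 ≤ a) (hl : 0 ≤ l) (hg : 0 ≤ g)
    (ha' : a ≤ R) (hl' : l ≤ R) (hg' : g ≤ R) :
    C^2 * (a + l + g)^2 ≤ R * (8 * (a+l) + 2*g) * (C - l + g)^2 := by
  have hR : 0 ≤ R := ha.trans ha'
  rcases hR.eq_or_lt with h | h
  · have h1 : a = 0 := by linarith
    have h2 : l = 0 := by linarith
    have h3 : g = 0 := by linarith
    subst h1 h2 h3; simp
  · have s1 : (a + l + g)^2 ≤ (8 * (a+l) + 2*g) * ((R + 2*g)/4) := by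
      have : (a + l + g)^2 ≤ (8 * (a+l) + 2*g) * ((a+l)/8 + g/2) := by
        nlinarith [mul_nonneg (add_nonneg ha hl) hg]
      refine this.trans (mul_le_mul_of_nonneg_left (by linarith) (by positivity))
    have s2 : C * (R + g) ≤ 2 * R * (C - R + g) := by
      nlinarith [mul_nonneg (sub_nonneg.2 hC) (sub_nonneg.2 hg')]
    have s3 : 2 * R * (C - R + g) ≤ 2 * R * (C - l + g) :=
      mul_le_mul_of_nonneg_left (by linarith) (by positivity)
    have hC0 : 0 ≤ C := by linarith
    have s4 : (C * (R+g))^2 ≤ (2 * R * (C - l + g))^2 :=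
      pow_le_pow_left₀ (by positivity) (s2.trans s3) 2
    have s5 : C^2 * (R * (R + 2*g)) ≤ (C * (R+g))^2 := by
      rw [mul_pow]
      exact mul_le_mul_of_nonneg_left (by nlinarith) (sq_nonneg _)
    have s6 : C^2 * (R + 2*g) ≤ 4 * R * (C - l + g)^2 := by
      refine le_of_mul_le_mul_left ?_ h
      nlinarith
    calc _ ≤ C^2 * ((8 * (a+l) + 2*g) * ((R + 2*g)/4)) :=
          mul_le_mul_of_nonneg_left s1 (sq_nonneg _)
      _ = (8 * (a+l) + 2*g)/4 * (C^2 * (R + 2*g)) := by ring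
      _ ≤ (8 * (a+l) + 2*g)/4 * (4 * R * (C - l + g)^2) :=
          mul_le_mul_of_nonneg_left s6 (by positivity)
      _ = _ := by ring

lemma minkowski (p q : Fin n → ℝ) (A B : ℝ) (hA : 0 ≤ A) (hB : 0 ≤ B)
    (hp : ∑ i, p i ^ 2 ≤ A^2) (hq : ∑ i, q i ^ 2 ≤ B^2) :
    ∑ i, (p i + q i)^2 ≤ (A + B)^2 := by
  have h1 := Finset.sum_mul_sq_le_sq_mul_sq Finset.univ p q
  have h2 : (∑ i, p i * q i)^2 ≤ (A*B)^2 := by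
    rw [mul_pow]
    refine h1.trans (mul_le_mul hp hq (Finset.sum_nonneg fun _ _ => sq_nonneg _) (sq_nonneg _))
  have h3 := abs_le_of_sq_le_sq' h2 (by positivity)
  have h4 : ∑ i, (p i + q i)^2 = ∑ i, p i ^ 2 + 2 * ∑ i, p i * q i + ∑ i, q i ^ 2 := by
    rw [Finset.mul_sum, ← Finset.sum_add_distrib, ← Finset.sum_add_distrib]
    exact Finset.sum_congr rfl fun i _ => by ring
  rw [h4]; nlinarith [h3.2]

lemma diff_le (z : Fin n → ℝ) (hz : ∑ i, z i ^ 2 ≤ 1) (j k : Fin n) : |z j - z k| ≤ Real.sqrt 2 := by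
  by_cases h : j = k
  · simp [h]
  · refine Real.abs_le_sqrt ?_
    have : z j ^ 2 + z k ^ 2 ≤ ∑ i, z i ^ 2 := by
      rw [← Finset.sum_pair (f := fun i => z i ^ 2) h]
      exact Finset.sum_le_univ_sum_of_nonneg fun i => sq_nonneg _
    nlinarith [sq_nonneg (z j + z k)]

lemma diff_P_le (hP : MJ.RowStochastic P) (z : Fin n → ℝ) (hz : ∑ i, z i ^ 2 ≤ 1) (j i : Fin n) :
    |z j - (P *ᵥ z) i| ≤ Real.sqrt 2 := by
  have e : z j - (P *ᵥ z) i = ∑ k, P i k * (z j - z k) := by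
    simp only [mul_sub, Finset.sum_sub_distrib, ← Finset.sum_mul, hP.2, one_mul]; rfl
  rw [e]
  calc _ ≤ ∑ k, |P i k * (z j - z k)| := Finset.abs_sum_le_sum_abs _ _
    _ ≤ ∑ k, P i k * Real.sqrt 2 := Finset.sum_le_sum fun k _ => by
        rw [abs_mul, abs_of_nonneg (hP.1 i k)]
        exact mul_le_mul_of_nonneg_left (diff_le z hz j k) (hP.1 i k)
    _ = _ := by rw [← Finset.sum_mul, hP.2, one_mul]

lemma emp_row {N : ℕ} (y : Fin (N+1) → Fin n) (z : Fin n → ℝ) (i : Fin n)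
    (hc : MJ.countState y i ≠ 0) :
    (MJ.countState y i : ℝ) * (((MJ.empMatrix y - P) *ᵥ z) i) = gn P y z i := by
  have hc' : (MJ.countState y i : ℝ) ≠ 0 := by exact_mod_cast hc
  have e1 : (MJ.countState y i : ℝ) * ((MJ.empMatrix y *ᵥ z) i) =
      ∑ s : Fin N, if y s.castSucc = i then z (y s.succ) else 0 := by
    simp only [Matrix.mulVec, dotProduct, MJ.empMatrix, Matrix.of_apply, if_neg hc, Finset.mul_sum]
    have : ∀ j, (MJ.countState y i : ℝ) * ((MJ.countTrans y i j : ℝ) / (MJ.countState y i : ℝ) * z j) =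
        ∑ s : Fin N, if y s.castSucc = i ∧ y s.succ = j then z j else 0 := by
      intro j
      rw [← mul_assoc, mul_div_cancel₀ _ hc', MJ.countTrans, Finset.card_filter]
      push_cast
      rw [Finset.sum_mul]
      exact Finset.sum_congr rfl fun s _ => by split_ifs <;> simp
    simp only [this]
    rw [Finset.sum_comm]
    refine Finset.sum_congr rfl fun s _ => ?_
    by_cases h : y s.castSucc = i <;> simp [h]
  have e2 : (MJ.countState y i : ℝ) * ((P *ᵥ z) i) =
      ∑ s : Fin N, if y s.castSucc = i then (P *ᵥ z) i else 0 := by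
    rw [MJ.countState, Finset.card_filter]
    push_cast
    rw [Finset.sum_mul]
    exact Finset.sum_congr rfl fun s _ => by split_ifs <;> simp
  rw [Matrix.sub_mulVec, Pi.sub_apply, mul_sub, e1, e2, ← Finset.sum_sub_distrib, gn]
  exact Finset.sum_congr rfl fun s _ => by split_ifs <;> simp

/-- perturbed next state. -/
def ca {N : ℕ} (x y : Fin (N+1) → Fin n) (i : Fin n) : ℝ :=
  ∑ s : Fin N, if x s.castSucc = i ∧ y s.castSucc = i ∧ y s.succ ≠ x s.succ then 1 else 0

/-- lost visits. -/
def cl {N : ℕ} (x y : Fin (N+1) → Fin n) (i : Fin n) : ℝ :=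
  ∑ s : Fin N, if x s.castSucc = i ∧ y s.castSucc ≠ i then 1 else 0

/-- gained visits. -/
def cg {N : ℕ} (x y : Fin (N+1) → Fin n) (i : Fin n) : ℝ :=
  ∑ s : Fin N, if y s.castSucc = i ∧ x s.castSucc ≠ i then 1 else 0

lemma ind_sum (a : Fin n) (Q : Fin n → Prop) [DecidablePred Q] :
    ∑ i, (if a = i ∧ Q i then (1:ℝ) else 0) = if Q a then 1 else 0 := by
  rw [Finset.sum_eq_single a (by intro b _ hb; simp [hb.symm]) (by simp)]
  simp

variable {N : ℕ}

lemma cast_le (x y : Fin (N+1) → Fin n) : (∑ s : Fin N, if y s.castSucc ≠ x s.castSucc then (1:ℝ) else 0)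
    ≤ (Finset.univ.filter fun t : Fin (N+1) => y t ≠ x t).card := by
  rw [Finset.card_filter]
  push_cast
  rw [Fin.sum_univ_castSucc]
  refine le_add_of_nonneg_right ?_
  split_ifs <;> norm_num

lemma succ_le (x y : Fin (N+1) → Fin n) : (∑ s : Fin N, if y s.succ ≠ x s.succ then (1:ℝ) else 0)
    ≤ (Finset.univ.filter fun t : Fin (N+1) => y t ≠ x t).card := by
  rw [Finset.card_filter]
  push_cast
  rw [Fin.sum_univ_succ]
  refine le_add_of_nonneg_left ?_
  split_ifs <;> norm_num

lemma sum_ca (x y : Fin (N+1) → Fin n) :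
    ∑ i, ca x y i ≤ (Finset.univ.filter fun t : Fin (N+1) => y t ≠ x t).card := by
  refine le_trans ?_ (succ_le x y)
  simp only [ca]
  rw [Finset.sum_comm]
  refine Finset.sum_le_sum fun s _ => ?_
  rw [ind_sum (x s.castSucc) (fun i => y s.castSucc = i ∧ y s.succ ≠ x s.succ)]
  split_ifs with h1 h2 h2
  · rfl
  · exact absurd h1.2 h2
  · norm_num
  · rfl

lemma sum_cl (x y : Fin (N+1) → Fin n) :
    ∑ i, cl x y i ≤ (Finset.univ.filter fun t : Fin (N+1) => y t ≠ x t).card := by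
  refine le_trans ?_ (cast_le x y)
  simp only [cl]
  rw [Finset.sum_comm]
  refine Finset.sum_le_sum fun s _ => ?_
  rw [ind_sum (x s.castSucc) (fun i => y s.castSucc ≠ i)]

lemma sum_cg (x y : Fin (N+1) → Fin n) :
    ∑ i, cg x y i ≤ (Finset.univ.filter fun t : Fin (N+1) => y t ≠ x t).card := by
  refine le_trans ?_ (cast_le x y)
  simp only [cg]
  rw [Finset.sum_comm]
  refine Finset.sum_le_sum fun s _ => ?_
  rw [ind_sum (y s.castSucc) (fun i => x s.castSucc ≠ i)]
  split_ifs with h1 h2 h2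
  · rfl
  · exact absurd (Ne.symm h1) h2
  · norm_num
  · rfl

lemma ca_nonneg (x y : Fin (N+1) → Fin n) (i) : 0 ≤ ca x y i :=
  Finset.sum_nonneg fun s _ => by split_ifs <;> norm_num
lemma cl_nonneg (x y : Fin (N+1) → Fin n) (i) : 0 ≤ cl x y i :=
  Finset.sum_nonneg fun s _ => by split_ifs <;> norm_num
lemma cg_nonneg (x y : Fin (N+1) → Fin n) (i) : 0 ≤ cg x y i :=
  Finset.sum_nonneg fun s _ => by split_ifs <;> norm_num

lemma count_rel (x y : Fin (N+1) → Fin n) (i : Fin n) :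
    (MJ.countState y i : ℝ) = MJ.countState x i - cl x y i + cg x y i := by
  simp only [MJ.countState, Finset.card_filter]
  push_cast
  rw [cl, cg, ← Finset.sum_sub_distrib, ← Finset.sum_add_distrib]
  refine Finset.sum_congr rfl fun s _ => ?_
  by_cases h1 : y s.castSucc = i <;> by_cases h2 : x s.castSucc = i <;> simp [h1, h2]

lemma gn_diff (hP : MJ.RowStochastic P) (x y : Fin (N+1) → Fin n) (z : Fin n → ℝ)
    (hz : ∑ i, z i ^ 2 ≤ 1) (i : Fin n) :
    |gn P y z i - gn P x z i| ≤ Real.sqrt 2 * (ca x y i + cl x y i + cg x y i) := by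
  rw [gn, gn, ← Finset.sum_sub_distrib, ca, cl, cg, ← Finset.sum_add_distrib,
    ← Finset.sum_add_distrib, Finset.mul_sum]
  refine (Finset.abs_sum_le_sum_abs _ _).trans (Finset.sum_le_sum fun s _ => ?_)
  by_cases h1 : y s.castSucc = i <;> by_cases h2 : x s.castSucc = i
  · by_cases h3 : y s.succ = x s.succ
    · simp [h1, h2, h3]
    · simp [h1, h2, h3]
      exact diff_le z hz _ _
  · simp [h1, h2]
    exact diff_P_le hP z hz _ _
  · simp [h1, h2]
    rw [abs_sub_comm]
    exact diff_P_le hP z hz _ _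
  · simp [h1, h2]

end Det

end MJH
namespace MJH

section Fin

variable {n N : ℕ} {P : Matrix (Fin n) (Fin n) ℝ} {piv : Fin n → ℝ}

lemma spec_le {m k : ℕ} (A : Matrix (Fin m) (Fin k) ℝ) (c : ℝ) (hc : 0 ≤ c)
    (h : ∀ z : Fin k → ℝ, ∑ i, z i ^ 2 ≤ 1 → ∑ i, (A *ᵥ z) i ^ 2 ≤ c^2) : MJ.spec A ≤ c := by
  refine csSup_le ⟨_, 0, by simp [MJ.l2], rfl⟩ ?_
  rintro _ ⟨z, hz, rfl⟩
  have hz' : ∑ i, z i ^ 2 ≤ 1 := by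
    have := (Real.sqrt_le_left (by norm_num)).1 hz
    simpa using this
  rw [MJ.l2]
  exact Real.sqrt_le_iff.2 ⟨hc, h z hz'⟩

lemma one_le_spec (hn : 0 < n) (hP : MJ.RowStochastic P) : 1 ≤ MJ.spec P := by
  have hn' : (0:ℝ) < n := by exact_mod_cast hn
  have hbdd : BddAbove {c : ℝ | ∃ x : Fin n → ℝ, MJ.l2 x ≤ 1 ∧ c = MJ.l2 (P.mulVec x)} := by
    refine ⟨Real.sqrt (∑ i, ∑ j, P i j ^ 2), ?_⟩
    rintro _ ⟨z, hz, rfl⟩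
    have hz' : ∑ i, z i ^ 2 ≤ 1 := by
      have := (Real.sqrt_le_left (by norm_num)).1 hz
      simpa using this
    rw [MJ.l2]
    refine Real.sqrt_le_sqrt (Finset.sum_le_sum fun i _ => ?_)
    refine (Finset.sum_mul_sq_le_sq_mul_sq Finset.univ (P i) z).trans ?_
    exact mul_le_of_le_one_right (Finset.sum_nonneg fun _ _ => sq_nonneg _) hz'
  refine le_csSup hbdd ⟨fun _ => 1 / Real.sqrt n, ?_, ?_⟩
  · simp [MJ.l2, Real.sq_sqrt hn'.le, hn'.ne']
  · have : P.mulVec (fun _ => 1 / Real.sqrt n) = fun _ => 1 / Real.sqrt n := by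
      funext i
      simp only [Matrix.mulVec, dotProduct, ← Finset.sum_mul, hP.2, one_mul]
    rw [this]
    simp [MJ.l2, Real.sq_sqrt hn'.le, hn'.ne']

lemma det_bound (hP : MJ.RowStochastic P) (x y : Fin (N+1) → Fin n) (R : ℕ)
    (hR : (Finset.univ.filter fun t : Fin (N+1) => y t ≠ x t).card = R) (pimin e : ℝ)
    (hN : 0 < N) (he : 0 < e) (hRN : (R:ℝ) ≤ N * (pimin/2 - e))
    (hcount : ∀ i, (pimin - 3/4*e) * N ≤ MJ.countState x i)
    (hnoise : ∀ z : Fin n → ℝ, ∑ i, z i ^ 2 ≤ 1 → ∑ i, gn P x z i ^ 2 ≤ (3/4*e*N)^2)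
    (z : Fin n → ℝ) (hz : ∑ i, z i ^ 2 ≤ 1) :
    ∑ i, ((MJ.empMatrix y - P) *ᵥ z) i ^ 2 ≤ ((3.75*e + 6 * (R / N)) / pimin)^2 := by
  have hN' : (0:ℝ) < N := by exact_mod_cast hN
  have hR0 : (0:ℝ) ≤ R := Nat.cast_nonneg _
  have hpe : 0 ≤ pimin/2 - e := by
    by_contra h
    push Not at h
    nlinarith
  have hp : 0 < pimin := by linarith
  set C := (pimin - 3/4*e) * N with hC
  have hC0 : 0 < C := mul_pos (by linarith) hN'
  have hCR : 2 * (R:ℝ) ≤ C := by rw [hC]; nlinarith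
  have sa := sum_ca x y
  have sl := sum_cl x y
  have sg := sum_cg x y
  rw [hR] at sa sl sg
  have a0 := ca_nonneg x y
  have l0 := cl_nonneg x y
  have g0 := cg_nonneg x y
  have a1 : ∀ i, ca x y i ≤ R := fun i =>
    (Finset.single_le_sum (fun i _ => a0 i) (Finset.mem_univ i)).trans sa
  have l1 : ∀ i, cl x y i ≤ R := fun i =>
    (Finset.single_le_sum (fun i _ => l0 i) (Finset.mem_univ i)).trans sl
  have g1 : ∀ i, cg x y i ≤ R := fun i =>
    (Finset.single_le_sum (fun i _ => g0 i) (Finset.mem_univ i)).trans sg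
  have hch : ∀ i, C - cl x y i + cg x y i ≤ MJ.countState y i := fun i => by
    rw [count_rel x y i]; linarith [hcount i]
  have hch2 : ∀ i, N * pimin / 2 ≤ MJ.countState y i := fun i => by
    refine le_trans ?_ (hch i)
    have := l1 i
    have := g0 i
    rw [hC]; nlinarith
  have hch0 : ∀ i, (0:ℝ) < MJ.countState y i := fun i =>
    lt_of_lt_of_le (by positivity) (hch2 i)
  set p : Fin n → ℝ := fun i => gn P x z i / MJ.countState y i with hpd
  set q : Fin n → ℝ := fun i => (gn P y z i - gn P x z i) / MJ.countState y i with hqd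
  have hd : ∀ i, ((MJ.empMatrix y - P) *ᵥ z) i = p i + q i := fun i => by
    have h1 := emp_row (P := P) y z i (by have := hch0 i; exact_mod_cast this.ne')
    simp only [hpd, hqd]
    rw [← add_div, add_sub_cancel, eq_div_iff (hch0 i).ne', mul_comm]
    exact h1
  have hp2 : ∑ i, p i ^ 2 ≤ (1.5 * e / pimin)^2 := by
    have : ∀ i, p i ^ 2 ≤ gn P x z i ^ 2 / (N * pimin/2)^2 := fun i => by
      simp only [hpd]; rw [div_pow]
      exact div_le_div_of_nonneg_left (sq_nonneg _) (by positivity)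
        (pow_le_pow_left₀ (by positivity) (hch2 i) 2)
    refine (Finset.sum_le_sum fun i _ => this i).trans ?_
    rw [← Finset.sum_div, div_le_iff₀ (by positivity)]
    refine (hnoise z hz).trans (le_of_eq ?_)
    rw [← mul_pow]; congr 1; field_simp; norm_num
  have hq2 : ∑ i, q i ^ 2 ≤ (6 * R / C)^2 := by
    have : ∀ i, q i ^ 2 ≤ 2 * (R * (8 * (ca x y i + cl x y i) + 2 * cg x y i)) / C^2 := fun i => by
      simp only [hqd]
      rw [div_pow, div_le_div_iff₀ (pow_pos (hch0 i) 2) (by positivity)]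
      have k1 := key_ineq C R _ _ _ hCR (a0 i) (l0 i) (g0 i) (a1 i) (l1 i) (g1 i)
      have k2 : (gn P y z i - gn P x z i)^2 ≤ 2 * (ca x y i + cl x y i + cg x y i)^2 := by
        have := gn_diff hP x y z hz i
        have h3 := pow_le_pow_left₀ (abs_nonneg _) this 2
        rw [sq_abs, mul_pow, Real.sq_sqrt (by norm_num)] at h3
        exact h3
      have k3 : (C - cl x y i + cg x y i)^2 ≤ (MJ.countState y i:ℝ)^2 :=
        pow_le_pow_left₀ (by linarith [l1 i, g0 i]) (hch i) 2
      have k4 : 0 ≤ R * (8 * (ca x y i + cl x y i) + 2 * cg x y i) :=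
        mul_nonneg hR0 (by linarith [a0 i, l0 i, g0 i])
      have k5 := mul_le_mul_of_nonneg_left k3 k4
      have k6 := mul_le_mul_of_nonneg_right k2 (sq_nonneg C)
      linarith
    refine (Finset.sum_le_sum fun i _ => this i).trans ?_
    rw [← Finset.sum_div, div_pow]
    refine div_le_div_of_nonneg_right ?_ (sq_nonneg C)
    rw [← Finset.mul_sum, ← Finset.mul_sum, Finset.sum_add_distrib, ← Finset.mul_sum,
      ← Finset.mul_sum, Finset.sum_add_distrib]
    nlinarith
  have hm := minkowski p q (1.5*e/pimin) (6*R/C) (by positivity) (by positivity) hp2 hq2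
  simp only [hd]
  refine hm.trans (pow_le_pow_left₀ (by positivity) ?_ 2)
  set ν := (R:ℝ)/N with hν
  have hν0 : 0 ≤ ν := by positivity
  have hRν : (R:ℝ) = ν * N := by rw [hν]; field_simp
  have hν1 : ν ≤ pimin/2 - e := by rw [hν, div_le_iff₀ hN']; linarith
  have h6 : 6 * (R:ℝ) / C ≤ (6*ν + 2.25*e)/pimin := by
    rw [div_le_div_iff₀ hC0 hp, hRν, hC]
    have : 6 * ν * pimin ≤ (6*ν + 2.25*e) * (pimin - 3/4*e) := by nlinarith
    nlinarith
  calc _ ≤ 1.5*e/pimin + (6*ν + 2.25*e)/pimin := by linarith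
    _ = _ := by rw [← add_div]; congr 1; ring

lemma tau_pos (hn : 2 ≤ n) (hP : MJ.RowStochastic P) (hPe : MJ.Ergodic' P)
    (hpi : MJ.IsStationary P piv) : 1 ≤ MJ.mixingTime P piv (1/4) := by
  by_contra h
  have h0 : MJ.mixingTime P piv (1/4) = 0 := by omega
  have hm := mix_mem (by omega) hP hPe hpi
  rw [h0, pow_zero] at hm
  let i : Fin n := ⟨0, by omega⟩
  let j : Fin n := ⟨1, by omega⟩
  have hij : i ≠ j := by simp [i, j]
  have key : ∀ a b : Fin n, a ≠ b → 1 - piv a + piv b ≤ 1/2 := by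
    intro a b hab
    have h1 := hm a
    have h2 : |(1 : Matrix (Fin n) (Fin n) ℝ) a a - piv a| + |(1 : Matrix (Fin n) (Fin n) ℝ) a b - piv b| ≤
        ∑ j, |(1 : Matrix (Fin n) (Fin n) ℝ) a j - piv j| := by
      rw [← Finset.sum_pair (f := fun j => |(1 : Matrix (Fin n) (Fin n) ℝ) a j - piv j|) hab]
      exact Finset.sum_le_univ_sum_of_nonneg fun i => abs_nonneg _
    rw [Matrix.one_apply_eq, Matrix.one_apply_ne hab] at h2
    have h3 := le_abs_self (1 - piv a)
    have h4 := neg_abs_le (0 - piv b)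
    linarith
  linarith [key i j hij, key j i hij.symm]

end Fin

end MJH
namespace MJH

lemma emp_one {N : ℕ} (P : Matrix (Fin 1) (Fin 1) ℝ) (hP : MJ.RowStochastic P)
    (y : Fin (N+1) → Fin 1) : MJ.empMatrix y - P = 0 := by
  ext i j
  have h1 := hP.2 i
  rw [Fin.sum_univ_one] at h1
  have h2 : P i j = 1 := by rw [← h1]; congr 1; exact Subsingleton.elim _ _
  have h3 : MJ.countTrans y i j = MJ.countState y i := by
    simp only [MJ.countTrans, MJ.countState]
    congr 1
    ext s
    simp [Subsingleton.elim (y s.succ) j]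
  rw [Matrix.sub_apply, h2, MJ.empMatrix, Matrix.of_apply, h3, Matrix.zero_apply]
  split_ifs with h
  · simp
  · have : (MJ.countState y i : ℝ) ≠ 0 := by exact_mod_cast h
    rw [div_self this, sub_self]

lemma prob_univ {n N : ℕ} {P : Matrix (Fin n) (Fin n) ℝ} {pi0 : Fin n → ℝ}
    (hP : MJ.RowStochastic P) (h0 : MJ.IsProbVec pi0) (S : Set (Fin (N+1) → Fin n))
    (hS : ∀ x, x ∈ S) : MJ.pathProb N P pi0 S = 1 := by
  rw [EE_prob]
  simp only [Set.indicator_of_mem (hS _)]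
  exact EE_const hP h0 N 1

lemma half_pow_le (e : ℝ) (he : 0 < e) :
    2 * (1/2:ℝ)^(⌈1.5 * Real.log e⁻¹⌉₊ + 3) ≤ e/4 := by
  set c := ⌈1.5 * Real.log e⁻¹⌉₊ with hc
  have h1 : 1.5 * Real.log e⁻¹ ≤ c := Nat.le_ceil _
  have hl2 := Real.log_two_gt_d9
  have h2 : (1/2:ℝ)^c ≤ e := by
    have e1 : (1/2:ℝ)^c = Real.exp (c * (-Real.log 2)) := by
      rw [Real.exp_nat_mul, Real.exp_neg, Real.exp_log (by norm_num)]; norm_num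
    rw [e1]
    refine (Real.exp_le_exp.2 ?_).trans_eq (Real.exp_log he)
    rw [Real.log_inv] at h1
    have hc0 : (0:ℝ) ≤ c := Nat.cast_nonneg _
    nlinarith
  rw [pow_add]
  nlinarith

end MJH

open MJ in
/-- concentration of the empirical transition matrix computed from a
perturbed trajectory with N' perturbed positions. -/
theorem stmt10 {n N : ℕ} (hn : 0 < n)
    (P : Matrix (Fin n) (Fin n) ℝ) (piv pi0 : Fin n → ℝ)
    (hP : RowStochastic P) (hPe : Ergodic' P) (hpiv : IsStationary P piv)
    (hpi0 : IsProbVec pi0)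
    (pimax pimin : ℝ) (hpimax : pimax = ⨆ i, piv i) (hpimin : pimin = ⨅ i, piv i)
    (τ : ℝ) (hτ : τ = (mixingTime P piv (1/4) : ℝ))
    (N' : ℕ)
    (Xh : (Fin (N+1) → Fin n) → (Fin (N+1) → Fin n))
    (hN' : ∀ x, (Finset.univ.filter fun t : Fin (N+1) => Xh x t ≠ x t).card = N')
    (hN'lt : (N' : ℝ) < N * pimin / 2)
    (ε εt : ℝ) (hε : 0 < ε) (hεt : εt = min (pimin / 2 - (N' : ℝ) / N) ε) :
    1 - 24 * n * τ * Real.log εt⁻¹ *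
        Real.exp (-(N : ℝ) / (100 * τ * pimax * Real.log εt⁻¹ * εt⁻¹ ^ 2))
      ≤ pathProb N P pi0
          {x | spec (empMatrix (Xh x) - P)
            ≤ 4 * pimin⁻¹ * spec P * (ε + 1.5 * ((N' : ℝ) / N))} := by
  have hn' : (0:ℝ) < n := by exact_mod_cast hn
  have hmax : ∀ i, piv i ≤ pimax := fun i => by
    rw [hpimax]; exact le_ciSup (Set.finite_range piv).bddAbove i
  have hmin : ∀ i, pimin ≤ piv i := fun i => by
    rw [hpimin]; exact ciInf_le (Set.finite_range piv).bddBelow i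
  have hR0 : (0:ℝ) ≤ N' := Nat.cast_nonneg _
  have hNp : 0 < (N:ℝ) * pimin := by linarith
  have hN0 : (0:ℝ) < N := by
    rcases (Nat.cast_nonneg N : (0:ℝ) ≤ N).eq_or_lt with h | h
    · rw [← h] at hNp; simp at hNp
    · exact h
  have hNpos : 0 < N := by exact_mod_cast hN0
  have hp : 0 < pimin := pos_of_mul_pos_right hNp hN0.le
  have hnp : n * pimin ≤ 1 := by
    rw [← hpiv.1.2]
    calc _ = ∑ _i : Fin n, pimin := by simp
      _ ≤ _ := Finset.sum_le_sum fun i _ => hmin i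
  have hν : (N':ℝ)/N < pimin/2 := by
    rw [div_lt_iff₀ hN0]; linarith
  have hν0 : 0 ≤ (N':ℝ)/N := by positivity
  have he : 0 < εt := by rw [hεt]; exact lt_min (by linarith) hε
  have he1 : εt ≤ pimin/2 - (N':ℝ)/N := by rw [hεt]; exact min_le_left _ _
  have he2 : εt ≤ ε := by rw [hεt]; exact min_le_right _ _
  have hspec : 1 ≤ spec P := MJH.one_le_spec hn hP
  have hrhs : (3.75*εt + 6 * ((N':ℝ) / N)) / pimin ≤
      4 * pimin⁻¹ * spec P * (ε + 1.5 * ((N' : ℝ) / N)) := by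
    have h1 : (3.75*εt + 6 * ((N':ℝ) / N)) / pimin ≤ 4 * pimin⁻¹ * (ε + 1.5 * ((N' : ℝ) / N)) := by
      rw [div_eq_mul_inv, mul_assoc 4, mul_left_comm, mul_comm _ pimin⁻¹]
      exact mul_le_mul_of_nonneg_left (by linarith) (by positivity)
    refine h1.trans ?_
    have h2 : 0 ≤ 4 * pimin⁻¹ * (ε + 1.5 * ((N' : ℝ) / N)) := by positivity
    nlinarith
  have hlhs0 : 0 ≤ (3.75*εt + 6 * ((N':ℝ) / N)) / pimin := by positivity
  have hτ0 : 0 ≤ τ := by rw [hτ]; exact Nat.cast_nonneg _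
  rcases Nat.lt_or_ge n 2 with hn2 | hn2
  · obtain rfl : n = 1 := by omega
    rw [MJH.prob_univ hP hpi0]
    · have hlog : 0 ≤ Real.log εt⁻¹ := by
        refine Real.log_nonneg ((one_le_inv₀ he).2 ?_)
        norm_num at hnp
        linarith
      have : 0 ≤ 24 * ((1:ℕ):ℝ) * τ * Real.log εt⁻¹ *
        Real.exp (-(N : ℝ) / (100 * τ * pimax * Real.log εt⁻¹ * εt⁻¹ ^ 2)) := by positivity
      linarith
    · intro x
      simp only [Set.mem_ofPred_eq]
      rw [MJH.emp_one P hP]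
      refine MJH.spec_le _ _ (hlhs0.trans hrhs) fun z _ => ?_
      simp only [Matrix.zero_mulVec, Pi.zero_apply]
      simp only [ne_eq, OfNat.ofNat_ne_zero, not_false_eq_true, zero_pow, Finset.sum_const_zero]
      exact sq_nonneg _
  · have hn2' : (2:ℝ) ≤ n := by exact_mod_cast hn2
    have hp2 : pimin ≤ 1/2 := by nlinarith
    have he4 : εt ≤ 1/4 := by linarith
    have hem : ∀ i, εt ≤ piv i / 2 := fun i => by linarith [hmin i]
    have i0 : Fin n := ⟨0, hn⟩
    have hm0 : 0 < pimax := by linarith [hmin i0, hmax i0]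
    set L := Real.log εt⁻¹ with hL
    have hL1 : 1.38 ≤ L := by
      have h1 : Real.log 4 ≤ L := by
        refine Real.log_le_log (by norm_num) ?_
        rw [le_inv_comm₀ (by norm_num) he]; linarith
      have h2 : Real.log 4 = 2 * Real.log 2 := by
        rw [show (4:ℝ) = 2^2 by norm_num, Real.log_pow]; norm_num
      linarith [Real.log_two_gt_d9]
    have hτ1 : 1 ≤ τ := by
      rw [hτ]; exact_mod_cast MJH.tau_pos hn2 hP hPe hpiv
    set k := ⌈1.5 * L⌉₊ + 3 with hk
    set q := mixingTime P piv (1/4) * k with hq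
    have hδ : ∀ a, ∑ j, |(P^q) a j - piv j| ≤ εt/4 := fun a =>
      (MJH.mix_pow hn hP hPe hpiv k a).trans (MJH.half_pow_le εt he)
    have hK : (q:ℝ) + 1 ≤ 6 * L * τ := by
      have h1 : (q:ℝ) = τ * k := by rw [hq, hτ]; push_cast; ring
      have h2 : (k:ℝ) ≤ 1.5 * L + 4 := by
        have := (Nat.ceil_lt_add_one (show 0 ≤ 1.5 * L by linarith)).le
        rw [hk]; push_cast; linarith
      rw [h1]
      nlinarith
    have hgood := MJH.prob_good hn hP hpi0 hpiv q N εt pimax _ hmax he he4 hem hδ rfl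
      {x | spec (empMatrix (Xh x) - P)
            ≤ 4 * pimin⁻¹ * spec P * (ε + 1.5 * ((N' : ℝ) / N))} (by
        intro x hx1 hx2
        simp only [Set.mem_ofPred_eq]
        refine (MJH.spec_le _ _ hlhs0 fun z hz => ?_).trans hrhs
        refine MJH.det_bound hP (MJH.res N x) (Xh (MJH.res N x)) N' (hN' _) pimin εt hNpos he ?_ ?_ ?_
          z hz
        · have : (N':ℝ) = N * ((N':ℝ)/N) := by field_simp
          rw [this]
          exact mul_le_mul_of_nonneg_left (by linarith) hN0.le
        · intro i
          refine le_trans ?_ (MJH.count_lower q N x (piv i - 3/4*εt) i fun r hr => hx2 r hr i)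
          exact mul_le_mul_of_nonneg_right (by linarith [hmin i]) hN0.le
        · intro z hz
          exact MJH.noise_bound q N x _ (3/4*εt) (by positivity) (by positivity) hNpos hx1 z hz)
    refine le_trans ?_ hgood
    have hq1 : (0:ℝ) < (q:ℝ) + 1 := by positivity
    have hLτ : 0 < L * τ := by nlinarith
    have hexp : Real.exp (-((N:ℝ)/(q+1) * (εt^2/(8*pimax)))) ≤
        Real.exp (-(N : ℝ) / (100 * τ * pimax * L * εt⁻¹ ^ 2)) := by
      refine Real.exp_le_exp.2 ?_
      have e1 : -(N : ℝ) / (100 * τ * pimax * L * εt⁻¹ ^ 2) =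
          -((N * εt^2) / (100 * τ * pimax * L)) := by
        have : L ≠ 0 := by linarith
        have : τ ≠ 0 := by linarith
        field_simp
      have e2 : (N:ℝ)/(q+1) * (εt^2/(8*pimax)) = (N * εt^2) / ((q+1) * (8*pimax)) := by
        rw [div_mul_div_comm]
      rw [e1, e2]
      refine neg_le_neg (div_le_div_of_nonneg_left (by positivity) (by positivity) ?_)
      have f1 := mul_le_mul_of_nonneg_right hK hm0.le
      have f2 := mul_pos hLτ hm0
      linarith
    have hpre : 3.3 * n * ((q:ℝ)+1) ≤ 24 * n * τ * L := by
      have := mul_le_mul_of_nonneg_left hK hn'.le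
      have f2 := mul_pos hn' hLτ
      linarith
    have := mul_le_mul hpre hexp (Real.exp_pos _).le (by have f2 := mul_pos hn' hLτ; linarith)
    linarith
end
end

section
/- Let P̄ ∈ ℝ^{n×n} have rank r with r-th largest singular value σ_r(P̄) > 0, let Δ ∈ ℝ^{n×n}, and set P = P̄ + Δ. Let Ū_r ∈ ℝ^{n×r} and U_r ∈ ℝ^{n×r} consist of the first r left singular vectors of P̄ and of P respectively. Then there exists an orthogonal matrix Q ∈ ℝ^{r×r} such that ‖U_r − Ū_r Q‖_F ≤ 2 √(2r) ‖Δ‖ / σ_r(P̄), where ‖·‖ is the spectral norm and ‖·‖_F the Frobenius norm. -/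
open scoped BigOperators
open Matrix

noncomputable section

namespace MJ

lemma aux_split {n r : ℕ} (h : r ≤ n) (f : Fin n → ℝ) :
    ∑ j, f j = ∑ i : Fin r, f (Fin.castLE h i) + ∑ j : Fin n, if r ≤ (j : ℕ) then f j else 0 := by
  obtain ⟨k, rfl⟩ := Nat.exists_eq_add_of_le h
  rw [Fin.sum_univ_add, Fin.sum_univ_add]
  have h1 : ∀ i : Fin r, ¬ (r ≤ (i : ℕ)) := fun i => by omega
  simp [h1]
  rfl

lemma aux_l2 {k : ℕ} (v : Fin k → ℝ) : l2 v = Real.sqrt (v ⬝ᵥ v) := by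
  simp [l2, dotProduct, sq]

lemma aux_nn {k : ℕ} (v : Fin k → ℝ) : 0 ≤ v ⬝ᵥ v :=
  Finset.sum_nonneg fun i _ => mul_self_nonneg _

lemma aux_l2_sq {k : ℕ} (v : Fin k → ℝ) : l2 v ^ 2 = v ⬝ᵥ v := by
  rw [aux_l2, Real.sq_sqrt (aux_nn v)]

lemma aux_l2_nn {k : ℕ} (v : Fin k → ℝ) : 0 ≤ l2 v := Real.sqrt_nonneg _

lemma aux_l2_smul {k : ℕ} (c : ℝ) (hc : 0 ≤ c) (v : Fin k → ℝ) : l2 (c • v) = c * l2 v := by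
  rw [aux_l2, aux_l2]
  simp only [smul_dotProduct, dotProduct_smul, smul_eq_mul]
  rw [← mul_assoc, Real.sqrt_mul (mul_self_nonneg c), Real.sqrt_mul_self hc]

lemma aux_frob {m k : ℕ} (A : Matrix (Fin m) (Fin k) ℝ) (x : Fin k → ℝ) :
    l2 (A *ᵥ x) ≤ frob A * l2 x := by
  unfold l2 frob
  rw [← Real.sqrt_mul (by positivity)]
  apply Real.sqrt_le_sqrt
  rw [Finset.sum_mul]
  refine Finset.sum_le_sum fun i _ => ?_
  have := Finset.sum_mul_sq_le_sq_mul_sq Finset.univ (fun j => A i j) x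
  exact this

lemma aux_spec {m k : ℕ} (A : Matrix (Fin m) (Fin k) ℝ) (x : Fin k → ℝ) :
    l2 (A *ᵥ x) ≤ spec A * l2 x := by
  by_cases hx : l2 x = 0
  · have := aux_frob A x
    rw [hx] at this ⊢
    simpa using this
  have hp : 0 < l2 x := lt_of_le_of_ne (aux_l2_nn x) (Ne.symm hx)
  have hb : BddAbove {c : ℝ | ∃ x : Fin k → ℝ, l2 x ≤ 1 ∧ c = l2 (A.mulVec x)} := by
    refine ⟨frob A, ?_⟩
    rintro c ⟨y, hy, rfl⟩
    refine (aux_frob A y).trans ?_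
    exact mul_le_of_le_one_right (Real.sqrt_nonneg _) hy
  have := le_csSup hb ⟨(l2 x)⁻¹ • x, by
    rw [aux_l2_smul _ (by positivity)]; field_simp; exact le_refl _, rfl⟩
  rw [mulVec_smul, aux_l2_smul _ (by positivity)] at this
  unfold spec
  rw [inv_mul_le_iff₀ hp] at this
  linarith

lemma aux_spec_nn {m k : ℕ} (A : Matrix (Fin m) (Fin k) ℝ) : 0 ≤ spec A := by
  apply Real.sSup_nonneg
  rintro c ⟨y, hy, rfl⟩
  exact aux_l2_nn _

lemma aux_spec_sq {m k : ℕ} (A : Matrix (Fin m) (Fin k) ℝ) (x : Fin k → ℝ) :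
    (A *ᵥ x) ⬝ᵥ (A *ᵥ x) ≤ spec A ^ 2 * (x ⬝ᵥ x) := by
  rw [← aux_l2_sq, ← aux_l2_sq, ← mul_pow]
  exact pow_le_pow_left₀ (aux_l2_nn _) (aux_spec A x) 2

lemma aux_orth {m k : ℕ} (U : Matrix (Fin m) (Fin k) ℝ) (h : Uᵀ * U = 1) (x : Fin k → ℝ) :
    (U *ᵥ x) ⬝ᵥ (U *ᵥ x) = x ⬝ᵥ x := by
  rw [dotProduct_mulVec, ← mulVec_transpose, mulVec_mulVec, h, one_mulVec]

lemma aux_diag {n : ℕ} (S : Matrix (Fin n) (Fin n) ℝ)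
    (h : ∀ i j : Fin n, (i : ℕ) ≠ (j : ℕ) → S i j = 0) (y : Fin n → ℝ) (i : Fin n) :
    (S *ᵥ y) i = S i i * y i := by
  have e : (S *ᵥ y) i = ∑ j, S i j * y j := rfl
  rw [e, Finset.sum_eq_single i]
  · intro j _ hj
    rw [h i j (fun e => hj (Fin.ext e.symm)), zero_mul]
  · simp

/-- A subspace of large dimension meets the common kernel of few coordinates. -/
lemma aux_inter {n : ℕ} (A : Submodule ℝ (Fin n → ℝ)) (W : Matrix (Fin n) (Fin n) ℝ)
    (s : Finset (Fin n)) (hs : s.card < Module.finrank ℝ A) :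
    ∃ x ∈ A, x ≠ 0 ∧ ∀ j ∈ s, (W *ᵥ x) j = 0 := by
  let f : A →ₗ[ℝ] (s → ℝ) :=
    (LinearMap.funLeft ℝ ℝ (fun j : s => (j : Fin n))) ∘ₗ W.mulVecLin ∘ₗ A.subtype
  have hk : LinearMap.ker f ≠ ⊥ := LinearMap.ker_ne_bot_of_finrank_lt (by simpa using hs)
  obtain ⟨x, hx, hx0⟩ := (Submodule.ne_bot_iff _).1 hk
  refine ⟨x, x.2, by simpa using hx0, fun j hj => ?_⟩
  have := congrFun (LinearMap.mem_ker.1 hx) ⟨j, hj⟩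
  simpa [f, LinearMap.funLeft] using this

lemma aux_pos {n : ℕ} (x : Fin n → ℝ) (hx : x ≠ 0) : 0 < x ⬝ᵥ x :=
  lt_of_le_of_ne (aux_nn x) (fun h => hx (dotProduct_self_eq_zero.1 h.symm))

lemma aux_svd_norm {n : ℕ} {A U S V : Matrix (Fin n) (Fin n) ℝ} (h : IsSVD A U S V)
    (x : Fin n → ℝ) :
    (A *ᵥ x) ⬝ᵥ (A *ᵥ x) = ∑ i, S i i ^ 2 * ((Vᵀ *ᵥ x) i) ^ 2 := by
  obtain ⟨hU, hV, hA, hd, -, -⟩ := h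
  rw [hA, ← mulVec_mulVec, ← mulVec_mulVec, aux_orth U hU]
  simp only [dotProduct, aux_diag S hd]
  exact Finset.sum_congr rfl fun i _ => by ring

lemma aux_V {n : ℕ} {V : Matrix (Fin n) (Fin n) ℝ} (hV : Vᵀ * V = 1)
    (x : Fin n → ℝ) : ∑ i, ((Vᵀ *ᵥ x) i) ^ 2 = x ⬝ᵥ x := by
  have := aux_orth Vᵀ (by rw [transpose_transpose]; exact mul_eq_one_comm.1 hV) x
  rw [← this]
  simp [dotProduct, sq]

/-- The singular value of index `r` (0-based) of a perturbed rank `r` matrix is small. -/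
lemma aux_small {n r : ℕ} {Pb Δ U S V : Matrix (Fin n) (Fin n) ℝ} (hrank : Pb.rank = r)
    (h : IsSVD (Pb + Δ) U S V) (j : Fin n) (hj : r ≤ (j : ℕ)) : S j j ≤ spec Δ := by
  have hrn : r < n := lt_of_le_of_lt hj j.2
  have hSj : S j j ≤ S ⟨r, hrn⟩ ⟨r, hrn⟩ := h.2.2.2.2.2 r j hrn hrn j.2 j.2 hj
  refine hSj.trans ?_
  set s := S ⟨r, hrn⟩ ⟨r, hrn⟩ with hs
  have hs0 : 0 ≤ s := h.2.2.2.2.1 _ _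
  have hker : Module.finrank ℝ (LinearMap.ker Pb.mulVecLin) = n - r := by
    have := LinearMap.finrank_range_add_finrank_ker Pb.mulVecLin
    rw [← Matrix.rank, hrank] at this
    simp at this
    omega
  obtain ⟨x, hxA, hx0, hx⟩ := aux_inter (LinearMap.ker Pb.mulVecLin) Vᵀ
    (Finset.Ioi ⟨r, hrn⟩) (by rw [hker, Fin.card_Ioi]; simp; omega)
  have hPx : Pb *ᵥ x = 0 := by simpa using hxA
  have h1 := aux_svd_norm h x
  rw [add_mulVec, hPx, zero_add] at h1
  have h2 : s ^ 2 * (x ⬝ᵥ x) ≤ spec Δ ^ 2 * (x ⬝ᵥ x) := by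
    refine le_trans ?_ (h1 ▸ aux_spec_sq Δ x)
    rw [← aux_V h.2.1 x, Finset.mul_sum]
    refine Finset.sum_le_sum fun i _ => ?_
    by_cases hi : (⟨r, hrn⟩ : Fin n) < i
    · rw [hx i (by simpa using hi)]; simp
    · have hi' : (i : ℕ) ≤ r := by
        have := not_lt.1 hi
        exact this
      have : s ≤ S i i := h.2.2.2.2.2 i r i.2 i.2 hrn hrn hi'
      gcongr
  have h3 := le_of_mul_le_mul_right h2 (aux_pos x hx0)
  exact (sq_le_sq₀ hs0 (aux_spec_nn Δ)).1 h3

lemma aux_large {n r : ℕ} {Pb U S V : Matrix (Fin n) (Fin n) ℝ}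
    (h : IsSVD Pb U S V) (j : Fin n) (hj : (j : ℕ) < r) (hrn : r ≤ n) :
    singVal Pb r ≤ S j j := by
  have hn : r - 1 < n := by omega
  have hSj : S ⟨r - 1, hn⟩ ⟨r - 1, hn⟩ ≤ S j j :=
    h.2.2.2.2.2 j (r-1) j.2 j.2 hn hn (by omega)
  refine le_trans ?_ hSj
  set s := S ⟨r - 1, hn⟩ ⟨r - 1, hn⟩ with hs
  have hs0 : 0 ≤ s := h.2.2.2.2.1 _ _
  refine Real.sSup_le ?_ hs0
  rintro c ⟨W, hW, hc⟩
  obtain ⟨x, hxA, hx0, hx⟩ := aux_inter W Vᵀ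
    (Finset.Iio ⟨r - 1, hn⟩) (by rw [hW, Fin.card_Iio]; simp; omega)
  have hcx := hc x hxA
  have h2 : (Pb *ᵥ x) ⬝ᵥ (Pb *ᵥ x) ≤ s ^ 2 * (x ⬝ᵥ x) := by
    rw [aux_svd_norm h x, ← aux_V h.2.1 x, Finset.mul_sum]
    refine Finset.sum_le_sum fun i _ => ?_
    by_cases hi : i < (⟨r - 1, hn⟩ : Fin n)
    · rw [hx i (by simpa using hi)]; simp
    · have hi' : r - 1 ≤ (i : ℕ) := by
        have := not_lt.1 hi
        exact this
      have : S i i ≤ s := h.2.2.2.2.2 (r-1) i hn hn i.2 i.2 hi'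
      have h0 : 0 ≤ S i i := h.2.2.2.2.1 _ _
      gcongr
  have hxp : 0 < l2 x := by
    rw [aux_l2]; exact Real.sqrt_pos.2 (aux_pos x hx0)
  have h3 : l2 (Pb *ᵥ x) ≤ s * l2 x := by
    rw [← sq_le_sq₀ (aux_l2_nn _) (by positivity), mul_pow, aux_l2_sq, aux_l2_sq]
    exact h2
  exact le_of_mul_le_mul_right (hcx.trans h3) hxp

lemma aux_polar {r : ℕ} (M : Matrix (Fin r) (Fin r) ℝ)
    (hM : ∀ x, (M *ᵥ x) ⬝ᵥ (M *ᵥ x) ≤ x ⬝ᵥ x) :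
    ∃ Q : Matrix (Fin r) (Fin r) ℝ, Qᵀ * Q = 1 ∧ (Mᵀ * M).trace ≤ (Qᵀ * M).trace := by
  have hH : (Mᵀ * M).IsHermitian := by
    have := isHermitian_conjTranspose_mul_self M
    simpa [conjTranspose_eq_transpose_of_trivial] using this
  obtain ⟨B, lam, hB, hlam⟩ : ∃ (B : Matrix (Fin r) (Fin r) ℝ) (lam : Fin r → ℝ),
      Bᵀ * B = 1 ∧ Bᵀ * (Mᵀ * M) * B = diagonal lam := by
    have hu : (hH.eigenvectorUnitary : Matrix (Fin r) (Fin r) ℝ)ᵀ *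
        (hH.eigenvectorUnitary : Matrix (Fin r) (Fin r) ℝ) = 1 := by
      have := Unitary.coe_star_mul_self hH.eigenvectorUnitary
      simpa [star_eq_conjTranspose, conjTranspose_eq_transpose_of_trivial] using this
    refine ⟨hH.eigenvectorUnitary, hH.eigenvalues, hu, ?_⟩
    have hs := hH.spectral_theorem
    rw [Unitary.conjStarAlgAut_apply] at hs
    have hst : (star (hH.eigenvectorUnitary : Matrix (Fin r) (Fin r) ℝ)) =
      (hH.eigenvectorUnitary : Matrix (Fin r) (Fin r) ℝ)ᵀ := by
      rw [star_eq_conjTranspose, conjTranspose_eq_transpose_of_trivial]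
    rw [hst] at hs
    generalize (hH.eigenvectorUnitary : Matrix (Fin r) (Fin r) ℝ) = B at *
    generalize hH.eigenvalues = lam at *
    rw [hs]
    calc _ = (Bᵀ * B) * (diagonal (RCLike.ofReal ∘ lam)) * (Bᵀ * B) := by
          simp only [Matrix.mul_assoc]
      _ = _ := by rw [hu]; simp
  have hB' : B * Bᵀ = 1 := mul_eq_one_comm.1 hB
  set G := M * B with hG
  have hGG : Gᵀ * G = diagonal lam := by
    rw [← hlam, hG, transpose_mul]; simp only [Matrix.mul_assoc]
  have hg : ∀ i j, (fun k => G k i) ⬝ᵥ (fun k => G k j) = if i = j then lam i else 0 := by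
    intro i j
    have := congrFun (congrFun hGG i) j
    rw [diagonal_apply] at this
    rw [← this]; rfl
  have hl0 : ∀ i, 0 ≤ lam i := fun i => by
    have := hg i i
    rw [if_pos rfl] at this
    rw [← this]; exact aux_nn _
  have hl1 : ∀ i, lam i ≤ 1 := fun i => by
    have := hg i i
    rw [if_pos rfl] at this
    rw [← this]
    have h2 := hM (fun k => B k i)
    have h3 : (fun k => B k i) ⬝ᵥ (fun k => B k i) = 1 := by
      have := congrFun (congrFun hB i) i
      rw [one_apply_eq] at this
      rw [← this]; rfl
    rw [h3] at h2
    exact h2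
  let v : Fin r → EuclideanSpace ℝ (Fin r) :=
    fun i => WithLp.toLp 2 (fun k => (Real.sqrt (lam i))⁻¹ * G k i)
  have hv : Orthonormal ℝ (({i | lam i ≠ 0} : Set (Fin r)).domRestrict v) := by
    rw [orthonormal_iff_ite]
    rintro ⟨i, hi⟩ ⟨j, hj⟩
    have hi' : 0 < lam i := lt_of_le_of_ne (hl0 i) (Ne.symm hi)
    have h1 : inner ℝ (v i) (v j) =
        (Real.sqrt (lam i))⁻¹ * (Real.sqrt (lam j))⁻¹ * (if i = j then lam i else 0) := by
      rw [← hg i j]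
      simp only [v, PiLp.inner_apply, dotProduct, Finset.mul_sum]
      refine Finset.sum_congr rfl fun k _ => ?_
      simp
      ring
    simp only [Subtype.mk.injEq]
    refine Eq.trans h1 ?_
    by_cases hij : i = j
    · subst hij
      simp only [if_true]
      rw [← mul_inv, Real.mul_self_sqrt hi'.le]
      field_simp
    · simp [hij]
  obtain ⟨a, ha⟩ := hv.exists_orthonormalBasis_extension_of_card_eq (by simp)
  let A : Matrix (Fin r) (Fin r) ℝ := fun k i => a i k
  have hA : Aᵀ * A = 1 := by
    ext i j
    have := orthonormal_iff_ite.1 a.orthonormal i j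
    rw [one_apply, ← this]
    rw [mul_apply, PiLp.inner_apply]
    refine Finset.sum_congr rfl fun k _ => ?_
    have e : Aᵀ i k * A k j = a i k * a j k := rfl
    rw [e]
    simp
    ring
  refine ⟨A * Bᵀ, ?_, ?_⟩
  · rw [transpose_mul, transpose_transpose]
    calc _ = B * (Aᵀ * A) * Bᵀ := by simp only [Matrix.mul_assoc]
      _ = 1 := by rw [hA, Matrix.mul_one, hB']
  · have e1 : (Mᵀ * M).trace = ∑ i, lam i := by
      rw [← trace_diagonal, ← hlam, trace_mul_comm (Bᵀ * (Mᵀ * M)) B, ← Matrix.mul_assoc, hB', Matrix.one_mul]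
    have e2 : ((A * Bᵀ)ᵀ * M).trace = (Aᵀ * G).trace := by
      rw [transpose_mul, transpose_transpose, hG, Matrix.mul_assoc, trace_mul_comm,
        Matrix.mul_assoc]
    rw [e1, e2, trace]
    refine Finset.sum_le_sum fun i _ => ?_
    have e3 : (Aᵀ * G).diag i = ∑ k, a i k * G k i := rfl
    rw [e3]
    by_cases hi : lam i = 0
    · have h0 := hg i i
      rw [if_pos rfl, hi] at h0
      have h0' := dotProduct_self_eq_zero.1 h0
      have : ∀ k, G k i = 0 := fun k => congrFun h0' k
      simp [this, hi]
    · have hi' : 0 < lam i := lt_of_le_of_ne (hl0 i) (Ne.symm hi)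
      rw [ha i hi]
      have e4 : ∑ k, v i k * G k i = (Real.sqrt (lam i))⁻¹ * lam i := by
        have h0 := hg i i
        rw [if_pos rfl] at h0
        have h0' : ∑ k, G k i * G k i = lam i := h0
        rw [← mul_right_inj' (a := (Real.sqrt (lam i))⁻¹)
          (inv_ne_zero (Real.sqrt_pos.2 hi').ne'), Finset.mul_sum] at h0'
        rw [← h0']
        refine Finset.sum_congr rfl fun k _ => ?_
        simp only [v]
        ring
      rw [e4]
      have hsp : 0 < Real.sqrt (lam i) := Real.sqrt_pos.2 hi'
      rw [le_inv_mul_iff₀ hsp]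
      have : Real.sqrt (lam i) ≤ 1 := Real.sqrt_le_one.2 (hl1 i)
      nlinarith

lemma aux_frob_sq {m k : ℕ} (A : Matrix (Fin m) (Fin k) ℝ) : frob A ^ 2 = (Aᵀ * A).trace := by
  unfold frob
  rw [Real.sq_sqrt (by positivity), Finset.sum_comm]
  simp [trace, mul_apply, sq]

lemma aux_trunc_orth {n r : ℕ} {U : Matrix (Fin n) (Fin n) ℝ} {E : Matrix (Fin n) (Fin r) ℝ}
    (hU : Uᵀ * U = 1) (h : r ≤ n) (hE : ∀ i (j : Fin r), E i j = U i (Fin.castLE h j)) :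
    Eᵀ * E = 1 := by
  ext i j
  have := congrFun (congrFun hU (Fin.castLE h i)) (Fin.castLE h j)
  simp only [mul_apply, transpose_apply, hE, one_apply] at this ⊢
  rw [this]
  simp

end MJ

open MJ in
/-- alignment bound for singular subspaces of a perturbed low-rank matrix. -/
theorem stmt16 {n r : ℕ} (Pb Δ : Matrix (Fin n) (Fin n) ℝ)
    (hrank : Pb.rank = r) (hσ : 0 < singVal Pb r)
    (Ubr Ur : Matrix (Fin n) (Fin r) ℝ)
    (hUbr : IsLeftSingTrunc Pb r Ubr) (hUr : IsLeftSingTrunc (Pb + Δ) r Ur) :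
    ∃ Q : Matrix (Fin r) (Fin r) ℝ, Qᵀ * Q = 1 ∧
      frob (Ur - Ubr * Q) ≤ 2 * Real.sqrt (2 * r) * spec Δ / singVal Pb r := by
  obtain ⟨U, S, V, hsvd, h, hE⟩ := hUbr
  obtain ⟨U', S', V', hsvd', h2, hF⟩ := hUr
  have hE : ∀ i (j : Fin r), Ubr i j = U i (Fin.castLE h j) := hE
  have hF : ∀ i (j : Fin r), Ur i j = U' i (Fin.castLE h j) := hF
  have hEE := aux_trunc_orth hsvd.1 h hE
  have hFF := aux_trunc_orth hsvd'.1 h hF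
  set σ := singVal Pb r with hσd
  set δ := spec Δ with hδ
  have hδ0 : 0 ≤ δ := aux_spec_nn Δ
  -- contraction
  have hcontr : ∀ x, ((Ubrᵀ * Ur) *ᵥ x) ⬝ᵥ ((Ubrᵀ * Ur) *ᵥ x) ≤ x ⬝ᵥ x := by
    intro x
    rw [← mulVec_mulVec, ← aux_orth Ur hFF x]
    generalize Ur *ᵥ x = w
    rw [← aux_V hsvd.1 w, aux_split h]
    have e : (Ubrᵀ *ᵥ w) ⬝ᵥ (Ubrᵀ *ᵥ w) = ∑ i : Fin r, (Uᵀ *ᵥ w) (Fin.castLE h i) ^ 2 := by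
      simp [dotProduct, mulVec, hE, sq]
    rw [e]
    refine le_add_of_nonneg_right (Finset.sum_nonneg fun j _ => ?_)
    split_ifs
    · positivity
    · exact le_refl _
  obtain ⟨Q, hQ, htr⟩ := aux_polar _ hcontr
  refine ⟨Q, hQ, ?_⟩
  -- key estimate per column
  have hcol : ∀ i : Fin r, 1 - ∑ j, (Urᵀ * Ubr) j i ^ 2 ≤ 4 * δ ^ 2 / σ ^ 2 := by
    intro i
    set i' := Fin.castLE h i with hi'
    have hSi : σ ≤ S i' i' := aux_large hsvd i' i.2 h
    have hSp : 0 < S i' i' := lt_of_lt_of_le hσ hSi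
    set e : Fin n → ℝ := fun k => U k i' with he
    set v : Fin n → ℝ := fun k => V k i' with hv
    have hee : e ⬝ᵥ e = 1 := by
      have := congrFun (congrFun hsvd.1 i') i'
      rw [one_apply_eq] at this
      rw [← this]; rfl
    have hvv : v ⬝ᵥ v = 1 := by
      have := congrFun (congrFun hsvd.2.1 i') i'
      rw [one_apply_eq] at this
      rw [← this]; rfl
    have hPv : Pb *ᵥ v = S i' i' • e := by
      have h1 : Vᵀ *ᵥ v = Pi.single i' 1 := by
        ext j
        have := congrFun (congrFun hsvd.2.1 j) i'
        rw [one_apply] at this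
        rw [Pi.single_apply, ← this]; rfl
      have h2 : S *ᵥ (Pi.single i' 1) = S i' i' • Pi.single i' (1:ℝ) := by
        ext j
        rw [aux_diag S hsvd.2.2.2.1]
        by_cases hj : j = i'
        · subst hj; simp
        · simp [hj]
      rw [hsvd.2.2.1, ← mulVec_mulVec, ← mulVec_mulVec, h1, h2, mulVec_smul]
      congr 1
      ext k
      simp [he]
    have hsum := aux_V hsvd'.1 e
    rw [hee, aux_split h] at hsum
    have e1 : ∑ j, (Urᵀ * Ubr) j i ^ 2 = ∑ j : Fin r, (U'ᵀ *ᵥ e) (Fin.castLE h j) ^ 2 := by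
      simp [mul_apply, mulVec, dotProduct, hE, hF, he, hi']
    rw [e1]
    have key : S i' i' ^ 2 * (∑ j : Fin n, if r ≤ (j : ℕ) then (U'ᵀ *ᵥ e) j ^ 2 else 0)
        ≤ 4 * δ ^ 2 := by
      have hw : ∀ j, S i' i' * (U'ᵀ *ᵥ e) j
          = S' j j * (V'ᵀ *ᵥ v) j - (U'ᵀ *ᵥ (Δ *ᵥ v)) j := by
        intro j
        have h3 : S i' i' • (U'ᵀ *ᵥ e) = S' *ᵥ (V'ᵀ *ᵥ v) - U'ᵀ *ᵥ (Δ *ᵥ v) := by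
          rw [← mulVec_smul, ← hPv, eq_sub_iff_add_eq, ← mulVec_add, ← add_mulVec, hsvd'.2.2.1,
            mulVec_mulVec, mulVec_mulVec, ← Matrix.mul_assoc, ← Matrix.mul_assoc, hsvd'.1,
            Matrix.one_mul]
        have := congrFun h3 j
        rw [Pi.sub_apply, aux_diag S' hsvd'.2.2.2.1] at this
        exact this
      have h4 : ∑ j, (V'ᵀ *ᵥ v) j ^ 2 = 1 := by rw [aux_V hsvd'.2.1, hvv]
      have h5 : ∑ j, (U'ᵀ *ᵥ (Δ *ᵥ v)) j ^ 2 ≤ δ ^ 2 := by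
        rw [aux_V hsvd'.1]
        simpa [hvv] using aux_spec_sq Δ v
      calc _ ≤ ∑ j, (2 * δ ^ 2 * (V'ᵀ *ᵥ v) j ^ 2 + 2 * (U'ᵀ *ᵥ (Δ *ᵥ v)) j ^ 2) := by
            rw [Finset.mul_sum]
            refine Finset.sum_le_sum fun j _ => ?_
            split_ifs with hj
            · rw [← mul_pow, hw j]
              have h6 : S' j j ≤ δ := aux_small hrank hsvd' j hj
              have h7 : 0 ≤ S' j j := hsvd'.2.2.2.2.1 _ _
              have h8 : S' j j ^ 2 * (V'ᵀ *ᵥ v) j ^ 2 ≤ δ ^ 2 * (V'ᵀ *ᵥ v) j ^ 2 := by gcongr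
              nlinarith [sq_nonneg (S' j j * (V'ᵀ *ᵥ v) j + (U'ᵀ *ᵥ (Δ *ᵥ v)) j)]
            · rw [mul_zero]; positivity
        _ = 2 * δ ^ 2 + 2 * ∑ j, (U'ᵀ *ᵥ (Δ *ᵥ v)) j ^ 2 := by
            rw [Finset.sum_add_distrib, ← Finset.mul_sum, ← Finset.mul_sum, h4, mul_one]
        _ ≤ _ := by linarith
    have ht : 0 ≤ ∑ j : Fin n, if r ≤ (j : ℕ) then (U'ᵀ *ᵥ e) j ^ 2 else 0 :=
      Finset.sum_nonneg fun j _ => by split_ifs <;> positivity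
    rw [le_div_iff₀ (by positivity)]
    have hσ2 : σ ^ 2 ≤ S i' i' ^ 2 := by gcongr
    have := mul_le_mul_of_nonneg_right hσ2 ht
    have e2 : 1 - ∑ j : Fin r, (U'ᵀ *ᵥ e) (Fin.castLE h j) ^ 2 =
      ∑ j : Fin n, if r ≤ (j : ℕ) then (U'ᵀ *ᵥ e) j ^ 2 else 0 := by linarith
    rw [e2]
    linarith
  have hMM : ((Ubrᵀ * Ur)ᵀ * (Ubrᵀ * Ur)).trace = ∑ i, ∑ j, (Urᵀ * Ubr) j i ^ 2 := by
    rw [trace_mul_comm]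
    have : Ubrᵀ * Ur = (Urᵀ * Ubr)ᵀ := by rw [transpose_mul, transpose_transpose]
    rw [this]
    generalize Urᵀ * Ubr = N
    simp [trace, mul_apply, sq]
  have hsumcol : (r : ℝ) - ((Ubrᵀ * Ur)ᵀ * (Ubrᵀ * Ur)).trace ≤ r * (4 * δ ^ 2 / σ ^ 2) := by
    have := Finset.sum_le_sum (fun i (_ : i ∈ Finset.univ) => hcol i)
    rw [Finset.sum_sub_distrib] at this
    simp at this
    rw [hMM]
    linarith
  have hfr : frob (Ur - Ubr * Q) ^ 2 = 2 * r - 2 * (Qᵀ * (Ubrᵀ * Ur)).trace := by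
    rw [aux_frob_sq]
    have h1 : (Ur - Ubr * Q)ᵀ * (Ur - Ubr * Q) =
        Urᵀ * Ur - (Qᵀ * (Ubrᵀ * Ur))ᵀ - Qᵀ * (Ubrᵀ * Ur) + Qᵀ * (Ubrᵀ * Ubr) * Q := by
      simp only [transpose_sub, transpose_mul, transpose_transpose, Matrix.mul_sub,
        Matrix.sub_mul, Matrix.mul_assoc]
      abel
    rw [h1, hEE, hFF, Matrix.mul_one, hQ]
    simp only [trace_add, trace_sub, trace_transpose, trace_one, Fintype.card_fin]
    ring
  have hrhs : 0 ≤ 2 * Real.sqrt (2 * r) * δ / σ := by positivity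
  rw [← sq_le_sq₀ (show 0 ≤ frob (Ur - Ubr * Q) from Real.sqrt_nonneg _) hrhs, hfr, div_pow, mul_pow, mul_pow,
    Real.sq_sqrt (by positivity)]
  have : (2:ℝ) ^ 2 * (2 * r) * δ ^ 2 / σ ^ 2 = 2 * (r * (4 * δ ^ 2 / σ ^ 2)) := by ring
  rw [this]
  linarith
end
end
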